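/- arXiv:2301.08920 — 10 statements merged into one kernel-verified Lean document; each statement's English description precedes it below -/
import Mathlib

section
/- Let V be a finite set and let F : 2^V → ℝ be a non-decreasing submodular function with F(∅) = 0. Define δ : 2^V → ℝ by δ(S) = min{F(S), F(V \ S)}. Then δ is symmetric, i.e. δ(S) = δ(V \ S) for all S ⊆ V, and δ is submodular, i.e. δ(A ∪ B) + δ(A ∩ B) ≤ δ(A) + δ(B) for all A, B ⊆ V. -/
open Finset

/-- If `F` is a non-decreasing submodular function on the finite set `V`
with `F ∅ = 0`, then `δ S = min (F S) (F Sᶜ)` is symmetric and submodular. -/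
theorem symmetrization_symmetric_and_submodular
    {V : Type*} [Fintype V] [DecidableEq V]
    (F : Finset V → ℝ)
    (hsub : ∀ A B : Finset V, F (A ∪ B) + F (A ∩ B) ≤ F A + F B)
    (hmono : ∀ ⦃A B : Finset V⦄, A ⊆ B → F A ≤ F B)
    (h0 : F ∅ = 0) :
    (∀ S : Finset V, min (F S) (F Sᶜ) = min (F Sᶜ) (F Sᶜᶜ)) ∧
    (∀ A B : Finset V,
      min (F (A ∪ B)) (F (A ∪ B)ᶜ) + min (F (A ∩ B)) (F (A ∩ B)ᶜ) ≤
        min (F A) (F Aᶜ) + min (F B) (F Bᶜ)) := by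
  refine ⟨fun S => by rw [compl_compl, min_comm], fun A B => ?_⟩
  have h1 := hsub A B
  have h2 := hsub Aᶜ Bᶜ
  rw [← Finset.compl_inter, ← Finset.compl_union] at h2
  have a1 : F (A ∩ B) ≤ F A := hmono Finset.inter_subset_left
  have a2 : F (A ∩ B) ≤ F B := hmono Finset.inter_subset_right
  have a3 : F (A ∪ B)ᶜ ≤ F Aᶜ :=
    hmono (Finset.compl_subset_compl.2 Finset.subset_union_left)
  have a4 : F (A ∪ B)ᶜ ≤ F Bᶜ :=
    hmono (Finset.compl_subset_compl.2 Finset.subset_union_right)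
  have u1 := min_le_left (F (A ∪ B)) (F (A ∪ B)ᶜ)
  have u2 := min_le_right (F (A ∪ B)) (F (A ∪ B)ᶜ)
  have i1 := min_le_left (F (A ∩ B)) (F (A ∩ B)ᶜ)
  have i2 := min_le_right (F (A ∩ B)) (F (A ∩ B)ᶜ)
  rcases min_choice (F A) (F Aᶜ) with hA | hA <;>
  rcases min_choice (F B) (F Bᶜ) with hB | hB <;>
  rw [hA, hB] <;> linarith
end

section
/- Let h be a finite set and F : 2^h → ℝ a non-decreasing submodular function with F(∅) = 0 and F({i}) > 0 for every i ∈ h, and let δ(S) = min{F(S), F(h \ S)}. Then (P_sym(F) ∩ 1^⊥) ⊆ B(δ) ⊆ 2·(P_sym(F) ∩ 1^⊥), where 1^⊥ = {x ∈ ℝ^h : ⟨x, 1⟩ = 0} and 2·K denotes the dilation {2x : x ∈ K}. -/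
open Finset Pointwise

/-- The base polytope `B(δ)` of a set function `δ` with `δ ∅ = 0` on the finite
ground set `V`. -/
def basePolytope {V : Type*} [Fintype V] (δ : Finset V → ℝ) : Set (V → ℝ) :=
  {x | (∑ i, x i) = δ Finset.univ ∧ ∀ S : Finset V, (∑ i ∈ S, x i) ≤ δ S}

/-- The symmetric submodular polyhedron `P_sym(F)`. -/
def symPolyhedron {V : Type*} [Fintype V] (F : Finset V → ℝ) : Set (V → ℝ) :=
  {x | ∀ S : Finset V, (∑ i ∈ S, |x i|) ≤ F S}

/-- For a non-decreasing submodular `F` with `F ∅ = 0` and `F {i} > 0`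
for all `i`, and `δ S = min (F S) (F Sᶜ)`, one has
`P_sym(F) ∩ 1^⊥ ⊆ B(δ) ⊆ 2 • (P_sym(F) ∩ 1^⊥)`. -/
theorem sym_polyhedron_base_polytope_sandwich
    {V : Type*} [Fintype V] [DecidableEq V]
    (F : Finset V → ℝ)
    (hsub : ∀ A B : Finset V, F (A ∪ B) + F (A ∩ B) ≤ F A + F B)
    (hmono : ∀ ⦃A B : Finset V⦄, A ⊆ B → F A ≤ F B)
    (h0 : F ∅ = 0)
    (hpos : ∀ i : V, 0 < F {i}) :
    symPolyhedron F ∩ {x : V → ℝ | (∑ i, x i) = 0}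
        ⊆ basePolytope (fun S => min (F S) (F Sᶜ)) ∧
    basePolytope (fun S => min (F S) (F Sᶜ))
        ⊆ (2 : ℝ) • (symPolyhedron F ∩ {x : V → ℝ | (∑ i, x i) = 0}) := by
  have hF : ∀ S, 0 ≤ F S := fun S => h0 ▸ hmono (Finset.empty_subset S)
  have hu : min (F Finset.univ) (F (Finset.univ : Finset V)ᶜ) = 0 := by
    rw [Finset.compl_univ, h0]; exact min_eq_right (hF _)
  constructor
  · rintro x ⟨hx, hx0⟩
    simp only [Set.mem_setOf_eq, symPolyhedron] at hx hx0
    refine ⟨hx0.trans hu.symm, fun S => le_min ?_ ?_⟩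
    · exact (Finset.sum_le_sum fun i _ => le_abs_self (x i)).trans (hx S)
    · have h1 := Finset.sum_add_sum_compl S x
      have h2 : ∑ i ∈ Sᶜ, -x i ≤ ∑ i ∈ Sᶜ, |x i| :=
        Finset.sum_le_sum fun i _ => neg_le_abs (x i)
      rw [Finset.sum_neg_distrib] at h2
      have h3 := hx Sᶜ
      linarith
  · rintro x ⟨hx0, hx⟩
    replace hx0 : ∑ i, x i = 0 := hx0.trans hu
    refine Set.mem_smul_set.2 ⟨(2⁻¹ : ℝ) • x, ⟨?_, ?_⟩, ?_⟩
    · intro S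
      have e : ∑ i ∈ S, |((2⁻¹ : ℝ) • x) i| = 2⁻¹ * ∑ i ∈ S, |x i| := by
        rw [Finset.mul_sum]
        refine Finset.sum_congr rfl fun i _ => ?_
        simp [abs_mul]
      rw [e, ← Finset.sum_filter_add_sum_filter_not S (fun i => 0 ≤ x i)]
      have a1 : ∑ i ∈ S with 0 ≤ x i, |x i| = ∑ i ∈ S with 0 ≤ x i, x i :=
        Finset.sum_congr rfl fun i hi => abs_of_nonneg (Finset.mem_filter.1 hi).2
      have a2 : ∑ i ∈ S with ¬ 0 ≤ x i, |x i| = -∑ i ∈ S with ¬ 0 ≤ x i, x i := by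
        rw [← Finset.sum_neg_distrib]
        exact Finset.sum_congr rfl fun i hi =>
          abs_of_neg (not_le.1 (Finset.mem_filter.1 hi).2)
      rw [a1, a2]
      have b1 := (hx (S.filter fun i => 0 ≤ x i)).trans (min_le_left _ _)
      have b2 := (hx (S.filter fun i => ¬ 0 ≤ x i)ᶜ).trans (min_le_right _ _)
      rw [compl_compl] at b2
      have b3 := Finset.sum_add_sum_compl (S.filter fun i => ¬ 0 ≤ x i) x
      have c1 := hmono (Finset.filter_subset (fun i => 0 ≤ x i) S)
      have c2 := hmono (Finset.filter_subset (fun i => ¬ 0 ≤ x i) S)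
      linarith
    · simp [← Finset.mul_sum, hx0]
    · simp [smul_smul]
end

section
/- Let h be a finite set and F : 2^h → ℝ a non-decreasing submodular function with F(∅) = 0 and F({i}) > 0 for every i ∈ h, and let δ(S) = min{F(S), F(h \ S)}. Then for every x ∈ ℝ^h, min_{u∈ℝ} ‖x − u·1‖_F ≤ δ̄(x) ≤ 2·min_{u∈ℝ} ‖x − u·1‖_F, where δ̄ is the Lovász extension of δ and ‖·‖_F is the norm associated with F. -/
open Finset

/-- The Lovász extension `δ̄(x) = max_{y ∈ B(δ)} ⟨y, x⟩`. -/
noncomputable def lovasz {V : Type*} [Fintype V] (δ : Finset V → ℝ) (x : V → ℝ) : ℝ :=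
  sSup {r | ∃ y ∈ basePolytope δ, r = ∑ i, y i * x i}

/-- The norm `‖x‖_F = max_{y ∈ P_sym(F)} ⟨y, x⟩` associated with a non-decreasing
submodular function `F`. -/
noncomputable def normF {V : Type*} [Fintype V] (F : Finset V → ℝ) (x : V → ℝ) : ℝ :=
  sSup {r | ∃ y ∈ symPolyhedron F, r = ∑ i, y i * x i}


/-- Initial segment of a ranking. -/
def headSet {V : Type*} [Fintype V] (r : V → ℕ) (k : ℕ) : Finset V :=
  Finset.univ.filter (fun i => r i < k)

theorem mem_headSet {V : Type*} [Fintype V] (r : V → ℕ) (k : ℕ) (i : V) :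
    i ∈ headSet r k ↔ r i < k := by
  simp [headSet]

theorem headSet_zero {V : Type*} [Fintype V] (r : V → ℕ) : headSet r 0 = ∅ := by
  ext i; simp [mem_headSet]

theorem headSet_mono {V : Type*} [Fintype V] (r : V → ℕ) {k l : ℕ} (h : k ≤ l) :
    headSet r k ⊆ headSet r l := by
  intro i hi
  rw [mem_headSet] at *
  omega

theorem headSet_succ {V : Type*} [Fintype V] [DecidableEq V] (r : V → ℕ)
    (hr : Function.Injective r) (k : ℕ) :
    headSet r (k+1) = headSet r k ∨
    ∃ v, r v = k ∧ v ∉ headSet r k ∧ headSet r (k+1) = insert v (headSet r k) := by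
  by_cases h : ∃ v, r v = k
  · obtain ⟨v, hv⟩ := h
    right
    refine ⟨v, hv, by simp [mem_headSet, hv], ?_⟩
    ext i
    simp only [mem_headSet, Finset.mem_insert]
    constructor
    · intro hi
      by_cases h' : r i = k
      · left; exact hr (h'.trans hv.symm)
      · right; omega
    · rintro (rfl | hi) <;> omega
  · left
    push Not at h
    ext i
    have := h i
    simp only [mem_headSet]
    omega

theorem abel_nonneg {V : Type*} [Fintype V] [DecidableEq V] (r : V → ℕ)
    (hr : Function.Injective r) (c d : V → ℝ) (hc : ∀ i j, r i ≤ r j → c j ≤ c i) (m : ℕ)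
    (hd : ∀ k ≤ m, 0 ≤ ∑ i ∈ headSet r k, d i) :
    ∀ k ≤ m, ∀ t : ℝ, (∀ i ∈ headSet r k, t ≤ c i) →
      0 ≤ ∑ i ∈ headSet r k, d i * (c i - t) := by
  intro k
  induction k with
  | zero => intro _ t _; simp [headSet_zero]
  | succ k ih =>
    intro hk t ht
    rcases headSet_succ r hr k with h | ⟨v, hv, hvn, h⟩
    · rw [h] at ht ⊢
      exact ih (by omega) t ht
    · have h1 := ih (by omega) (c v) (fun i hi => hc i v (by
        rw [mem_headSet] at hi; omega))
      have h2 := hd (k+1) hk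
      have h3 : t ≤ c v := ht v (by rw [mem_headSet]; omega)
      have h4 : ∑ i ∈ headSet r (k+1), d i * (c i - t)
          = ∑ i ∈ headSet r k, d i * (c i - c v)
            + (c v - t) * ∑ i ∈ headSet r (k+1), d i := by
        rw [Finset.mul_sum, h, Finset.sum_insert hvn, Finset.sum_insert hvn]
        have : ∑ i ∈ headSet r k, d i * (c i - t) = ∑ i ∈ headSet r k, d i * (c i - c v)
            + ∑ i ∈ headSet r k, (c v - t) * d i := by
          rw [← Finset.sum_add_distrib]
          exact Finset.sum_congr rfl (fun i _ => by ring)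
        rw [this]; ring
      rw [h4]
      have := mul_nonneg (sub_nonneg.2 h3) h2
      linarith

/-- greedy vector -/
def greedyVec {V : Type*} [Fintype V] (δ : Finset V → ℝ) (r : V → ℕ) (i : V) : ℝ :=
  δ (headSet r (r i + 1)) - δ (headSet r (r i))

theorem greedy_head {V : Type*} [Fintype V] [DecidableEq V] (δ : Finset V → ℝ) (r : V → ℕ)
    (hr : Function.Injective r) (h0 : δ ∅ = 0) (k : ℕ) :
    ∑ i ∈ headSet r k, greedyVec δ r i = δ (headSet r k) := by
  induction k with
  | zero => simp [headSet_zero, h0]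
  | succ k ih =>
    rcases headSet_succ r hr k with h | ⟨v, hv, hvn, h⟩
    · rw [h, ih]
    · conv_lhs => rw [h]
      rw [Finset.sum_insert hvn, ih, greedyVec, hv]
      ring

theorem greedy_le {V : Type*} [Fintype V] [DecidableEq V] (δ : Finset V → ℝ) (r : V → ℕ)
    (hr : Function.Injective r) (h0 : δ ∅ = 0)
    (hsub : ∀ A B : Finset V, δ (A ∪ B) + δ (A ∩ B) ≤ δ A + δ B) (S : Finset V) (k : ℕ) :
    ∑ i ∈ S ∩ headSet r k, greedyVec δ r i ≤ δ (S ∩ headSet r k) := by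
  induction k with
  | zero => simp [headSet_zero, h0]
  | succ k ih =>
    rcases headSet_succ r hr k with h | ⟨v, hv, hvn, h⟩
    · rw [h]; exact ih
    · by_cases hvS : v ∈ S
      · have h1 : S ∩ headSet r (k+1) = insert v (S ∩ headSet r k) := by
          rw [h, Finset.inter_insert_of_mem hvS]
        have h2 := hsub (S ∩ headSet r (k+1)) (headSet r k)
        have h3 : S ∩ headSet r (k+1) ∪ headSet r k = headSet r (k+1) := by
          rw [h]; ext i; simp only [mem_union, mem_inter, mem_insert]; grind
        have h4 : S ∩ headSet r (k+1) ∩ headSet r k = S ∩ headSet r k := by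
          rw [h]; ext i; simp only [mem_inter, mem_insert]; grind
        rw [h3, h4] at h2
        have h5 : ∑ i ∈ S ∩ headSet r (k+1), greedyVec δ r i
            = greedyVec δ r v + ∑ i ∈ S ∩ headSet r k, greedyVec δ r i := by
          rw [h1, Finset.sum_insert (by simp [hvn])]
        have h6 : greedyVec δ r v = δ (headSet r (k+1)) - δ (headSet r k) := by
          rw [greedyVec, hv]
        linarith
      · rw [h, Finset.inter_insert_of_notMem hvS]; exact ih

theorem delta_sub {V : Type*} [Fintype V] [DecidableEq V] (F : Finset V → ℝ)
    (hsub : ∀ A B : Finset V, F (A ∪ B) + F (A ∩ B) ≤ F A + F B)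
    (hmono : ∀ ⦃A B : Finset V⦄, A ⊆ B → F A ≤ F B) (A B : Finset V) :
    min (F (A ∪ B)) (F (A ∪ B)ᶜ) + min (F (A ∩ B)) (F (A ∩ B)ᶜ)
      ≤ min (F A) (F Aᶜ) + min (F B) (F Bᶜ) := by
  have a1 := min_le_left (F (A ∪ B)) (F (A ∪ B)ᶜ)
  have a2 := min_le_right (F (A ∪ B)) (F (A ∪ B)ᶜ)
  have b1 := min_le_left (F (A ∩ B)) (F (A ∩ B)ᶜ)
  have b2 := min_le_right (F (A ∩ B)) (F (A ∩ B)ᶜ)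
  have h1 := hsub A B
  have h2 := hsub Aᶜ Bᶜ
  rw [← Finset.compl_inter, ← Finset.compl_union] at h2
  have h3 := hmono (Finset.inter_subset_left : A ∩ B ⊆ A)
  have h4 := hmono (Finset.inter_subset_right : A ∩ B ⊆ B)
  have h5 := hmono (Finset.compl_subset_compl.2 (Finset.subset_union_left : A ⊆ A ∪ B))
  have h6 := hmono (Finset.compl_subset_compl.2 (Finset.subset_union_right : B ⊆ A ∪ B))
  rcases min_choice (F A) (F Aᶜ) with e | e <;> rcases min_choice (F B) (F Bᶜ) with e' | e' <;>
    rw [e, e'] <;> linarith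

theorem sym_bdd {V : Type*} [Fintype V] (F : Finset V → ℝ) (x : V → ℝ) :
    BddAbove {r | ∃ y ∈ symPolyhedron F, r = ∑ i, y i * x i} := by
  refine ⟨∑ i, F {i} * |x i|, ?_⟩
  rintro _ ⟨y, hy, rfl⟩
  refine Finset.sum_le_sum fun i _ => ?_
  have h := hy {i}
  rw [Finset.sum_singleton] at h
  calc y i * x i ≤ |y i * x i| := le_abs_self _
    _ = |y i| * |x i| := abs_mul _ _
    _ ≤ _ := mul_le_mul_of_nonneg_right h (abs_nonneg _)

theorem base_half {V : Type*} [Fintype V] [DecidableEq V] (F : Finset V → ℝ)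
    (hmono : ∀ ⦃A B : Finset V⦄, A ⊆ B → F A ≤ F B) (h0 : F ∅ = 0) (y : V → ℝ)
    (hy : y ∈ basePolytope (fun S => min (F S) (F Sᶜ))) :
    (∑ i, y i = 0) ∧ (fun i => y i / 2) ∈ symPolyhedron F := by
  obtain ⟨h1, h2⟩ := hy
  have hz : ∑ i, y i = 0 := by
    rw [h1]; simp only [Finset.compl_univ, h0]
    apply min_eq_right
    rw [← h0]; exact hmono (Finset.empty_subset _)
  refine ⟨hz, fun S => ?_⟩
  have e1 := Finset.sum_filter_add_sum_filter_not S (fun i => 0 ≤ y i) (fun i => |y i / 2|)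
  have e2 : ∑ i ∈ S.filter (fun i => 0 ≤ y i), |y i / 2|
      = (∑ i ∈ S.filter (fun i => 0 ≤ y i), y i) / 2 := by
    rw [Finset.sum_div]
    refine Finset.sum_congr rfl fun i hi => ?_
    rw [abs_of_nonneg (div_nonneg (Finset.mem_filter.1 hi).2 (by norm_num))]
  have e3 : ∑ i ∈ S.filter (fun i => ¬ 0 ≤ y i), |y i / 2|
      = - (∑ i ∈ S.filter (fun i => ¬ 0 ≤ y i), y i) / 2 := by
    rw [← Finset.sum_neg_distrib, Finset.sum_div]
    refine Finset.sum_congr rfl fun i hi => ?_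
    have := (Finset.mem_filter.1 hi).2
    rw [abs_of_nonpos (by linarith)]; ring
  have e4 := Finset.sum_add_sum_compl (S.filter (fun i => ¬ 0 ≤ y i)) y
  have f1 := (h2 (S.filter (fun i => 0 ≤ y i))).trans (min_le_left _ _)
  have f2 := (h2 (S.filter (fun i => ¬ 0 ≤ y i))ᶜ).trans (min_le_right _ _)
  rw [compl_compl] at f2
  have g1 := hmono (Finset.filter_subset (fun i => 0 ≤ y i) S)
  have g2 := hmono (Finset.filter_subset (fun i => ¬ 0 ≤ y i) S)
  show ∑ i ∈ S, |y i / 2| ≤ F S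
  linarith

theorem pair_le {V : Type*} [Fintype V] [DecidableEq V] (F : Finset V → ℝ)
    (hmono : ∀ ⦃A B : Finset V⦄, A ⊆ B → F A ≤ F B) (h0 : F ∅ = 0) (y : V → ℝ)
    (hy : y ∈ basePolytope (fun S => min (F S) (F Sᶜ))) (x : V → ℝ) (u : ℝ) :
    ∑ i, y i * x i ≤ 2 * normF F (fun i => x i - u) := by
  obtain ⟨hz, hs⟩ := base_half F hmono h0 y hy
  have : ∑ i, y i / 2 * (x i - u) ≤ normF F (fun i => x i - u) :=
    le_csSup (sym_bdd F _) ⟨_, hs, rfl⟩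
  have e : ∑ i, y i * x i = 2 * ∑ i, y i / 2 * (x i - u) := by
    have : ∑ i, y i * x i = ∑ i, y i * x i - u * ∑ i, y i := by rw [hz]; ring
    rw [this, Finset.mul_sum, Finset.mul_sum, ← Finset.sum_sub_distrib]
    exact Finset.sum_congr rfl fun i _ => by ring
  linarith

theorem exists_rank {V : Type*} [Fintype V] (x : V → ℝ) :
    ∃ n : ℕ, ∃ r : V ≃ Fin n, ∀ i j, r i ≤ r j → x j ≤ x i := by
  let e := Fintype.equivFin V
  let f : Fin (Fintype.card V) → ℝ := fun k => - x (e.symm k)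
  refine ⟨_, e.trans (Tuple.sort f).symm, fun i j h => ?_⟩
  have := Tuple.monotone_sort f h
  simp [f] at this
  exact this

theorem key {V : Type*} [Fintype V] [DecidableEq V] [Nonempty V]
    (F : Finset V → ℝ)
    (hsub : ∀ A B : Finset V, F (A ∪ B) + F (A ∩ B) ≤ F A + F B)
    (hmono : ∀ ⦃A B : Finset V⦄, A ⊆ B → F A ≤ F B)
    (h0 : F ∅ = 0)
    (hpos : ∀ i : V, 0 < F {i})
    (x : V → ℝ) :
    ∃ y ∈ basePolytope (fun S => min (F S) (F Sᶜ)), ∃ u : ℝ, ∀ z ∈ symPolyhedron F,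
      ∑ i, z i * (x i - u) ≤ ∑ i, y i * x i := by
  obtain ⟨n, ρ, hρ⟩ := exists_rank x
  set δ : Finset V → ℝ := fun S => min (F S) (F Sᶜ) with hδ
  let r : V → ℕ := fun i => (ρ i : ℕ)
  have hr : Function.Injective r := fun i j h => ρ.injective (Fin.ext h)
  have hrn : ∀ i, r i < n := fun i => (ρ i).2
  have hxr : ∀ i j, r i ≤ r j → x j ≤ x i := fun i j h => hρ i j h
  have hSn : headSet r n = univ := by ext i; simp [mem_headSet, hrn]
  have hF0 : ∀ S, 0 ≤ F S := fun S => h0 ▸ hmono (Finset.empty_subset S)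
  have hδ0 : δ ∅ = 0 := by simp [hδ, h0, hF0]
  have hδs := delta_sub F hsub hmono
  have hy : greedyVec δ r ∈ basePolytope δ := by
    refine ⟨?_, fun S => ?_⟩
    · rw [← hSn]; exact greedy_head δ r hr hδ0 n
    · have := greedy_le δ r hr hδ0 hδs S n
      rwa [hSn, Finset.inter_univ] at this
  have hysum := (base_half F hmono h0 _ hy).1
  -- crossing index
  let P : ℕ → Prop := fun k => F (headSet r k) ≤ F (headSet r k)ᶜ
  have hPn : ¬ P n := by
    obtain ⟨i⟩ := ‹Nonempty V›
    have h1 := hmono (Finset.subset_univ {i})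
    have h2 := hpos i
    simp only [P, hSn, Finset.compl_univ, h0]
    linarith
  have hP0 : P 0 := by simp [P, headSet_zero, h0, hF0]
  have hPm : ∀ k l, k ≤ l → P l → P k := by
    intro k l h hl
    have h1 := hmono (headSet_mono r h)
    have h2 := hmono (Finset.compl_subset_compl.2 (headSet_mono r h))
    exact h1.trans (hl.trans h2)
  obtain ⟨m, hm, hm'⟩ : ∃ m, P m ∧ ¬ P (m+1) := by
    by_contra hcon
    push Not at hcon
    exact hPn (Nat.rec hP0 (fun k hk => hcon k hk) n)
  have hmn : m < n := by
    by_contra hcon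
    exact hPn (hPm n m (by omega) hm)
  let p : V := ρ.symm ⟨m, hmn⟩
  have hp : r p = m := by simp [r, p]
  refine ⟨_, hy, x p, fun z hz => ?_⟩
  set y := greedyVec δ r with hydef
  have A1 : 0 ≤ ∑ i ∈ headSet r m, (y i - |z i|) * (x i - x p) := by
    refine abel_nonneg r hr x (fun i => y i - |z i|) hxr m ?_ m le_rfl (x p) ?_
    · intro k hk
      rw [Finset.sum_sub_distrib, greedy_head δ r hr hδ0 k]
      have h1 := hz (headSet r k)
      have h2 : δ (headSet r k) = F (headSet r k) := min_eq_left (hPm k m hk hm)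
      linarith
    · intro i hi
      rw [mem_headSet] at hi
      exact hxr i p (by omega)
  let r' : V → ℕ := fun i => n - r i
  have hr' : Function.Injective r' := by
    intro i j h
    apply hr
    have := hrn i; have := hrn j
    simp only [r'] at h
    omega
  have hS' : ∀ k, k ≤ n → headSet r' k = (headSet r (n - k + 1))ᶜ := by
    intro k hk
    ext i
    have := hrn i
    simp only [mem_headSet, Finset.mem_compl, r']
    omega
  have A2 : 0 ≤ ∑ i ∈ headSet r' (n - m), (-y i - |z i|) * (-x i - -x p) := by
    refine abel_nonneg r' hr' (fun i => -x i) (fun i => -y i - |z i|) ?_ (n - m) ?_ (n - m)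
      le_rfl (-x p) ?_
    · intro i j h
      have := hrn i; have := hrn j
      simp only [r'] at h
      exact neg_le_neg (hxr j i (by omega))
    · intro k hk
      rw [Finset.sum_sub_distrib, Finset.sum_neg_distrib]
      have h1 := hz (headSet r' k)
      rw [hS' k (by omega)] at h1 ⊢
      have h3 := Finset.sum_add_sum_compl (headSet r (n - k + 1)) y
      have h4 := greedy_head δ r hr hδ0 (n - k + 1)
      have h5 : ¬ P (n - k + 1) := fun h => hm' (hPm _ _ (by omega) h)
      have h2 : δ (headSet r (n - k + 1)) = F (headSet r (n - k + 1))ᶜ :=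
        min_eq_right (not_le.1 h5).le
      linarith
    · intro i hi
      have := hrn i
      simp only [mem_headSet, r'] at hi
      exact neg_le_neg (hxr p i (by omega))
  have hSm : headSet r' (n - m) = (headSet r (m+1))ᶜ := by
    rw [hS' _ (by omega)]; congr 2; omega
  rw [hSm] at A2
  have hins : headSet r (m+1) = insert p (headSet r m) := by
    ext i
    simp only [mem_headSet, Finset.mem_insert]
    constructor
    · intro hi
      by_cases h : r i = m
      · left; exact hr (h.trans hp.symm)
      · right; omega
    · rintro (rfl | h) <;> omega
  have hpn : p ∉ headSet r m := by simp [mem_headSet, hp]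
  have split : ∀ g : V → ℝ, g p = 0 →
      ∑ i, g i = ∑ i ∈ headSet r m, g i + ∑ i ∈ (headSet r (m+1))ᶜ, g i := by
    intro g hg
    rw [← Finset.sum_add_sum_compl (headSet r (m+1)) g]
    congr 1
    rw [hins, Finset.sum_insert hpn, hg, zero_add]
  have e : ∑ i, y i * x i = ∑ i, y i * (x i - x p) := by
    have : ∑ i, y i * x i = ∑ i, y i * x i - x p * ∑ i, y i := by rw [hysum]; ring
    rw [this, Finset.mul_sum, ← Finset.sum_sub_distrib]
    exact Finset.sum_congr rfl fun i _ => by ring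
  rw [e, split _ (by simp), split (fun i => y i * (x i - x p)) (by simp)]
  refine add_le_add ?_ ?_
  · rw [← sub_nonneg, ← Finset.sum_sub_distrib]
    refine A1.trans (Finset.sum_le_sum fun i hi => ?_)
    rw [mem_headSet] at hi
    have h1 := hxr i p (by omega)
    have h2 := le_abs_self (z i)
    nlinarith
  · rw [← sub_nonneg, ← Finset.sum_sub_distrib]
    refine A2.trans (Finset.sum_le_sum fun i hi => ?_)
    rw [Finset.mem_compl, mem_headSet] at hi
    have h1 := hxr p i (by omega)
    have h2 := neg_abs_le (z i)
    nlinarith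

/-- For a non-decreasing submodular `F` with `F ∅ = 0`, `F {i} > 0`,
and `δ S = min (F S) (F Sᶜ)`, the Lovász extension of `δ` is approximated within a
factor of `2` by `min_u ‖x − u·1‖_F`. -/
theorem lovasz_mscf_norm_approx
    {V : Type*} [Fintype V] [DecidableEq V]
    (F : Finset V → ℝ)
    (hsub : ∀ A B : Finset V, F (A ∪ B) + F (A ∩ B) ≤ F A + F B)
    (hmono : ∀ ⦃A B : Finset V⦄, A ⊆ B → F A ≤ F B)
    (h0 : F ∅ = 0)
    (hpos : ∀ i : V, 0 < F {i})
    (x : V → ℝ) :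
    (⨅ u : ℝ, normF F (fun i => x i - u)) ≤ lovasz (fun S => min (F S) (F Sᶜ)) x ∧
    lovasz (fun S => min (F S) (F Sᶜ)) x ≤ 2 * ⨅ u : ℝ, normF F (fun i => x i - u) := by
  have hF0 : ∀ S, 0 ≤ F S := fun S => h0 ▸ hmono (Finset.empty_subset S)
  have hzero : (0 : V → ℝ) ∈ symPolyhedron F := fun S => by simpa using hF0 S
  have hne : ∀ w : V → ℝ, {r | ∃ y ∈ symPolyhedron F, r = ∑ i, y i * w i}.Nonempty :=
    fun w => ⟨_, 0, hzero, rfl⟩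
  have hnn : ∀ w : V → ℝ, 0 ≤ normF F w := fun w =>
    le_csSup (sym_bdd F w) ⟨0, hzero, by simp⟩
  have hbb : BddBelow (Set.range fun u : ℝ => normF F (fun i => x i - u)) :=
    ⟨0, by rintro _ ⟨u, rfl⟩; exact hnn _⟩
  have hup : ∀ y ∈ basePolytope (fun S => min (F S) (F Sᶜ)),
      ∑ i, y i * x i ≤ 2 * ⨅ u : ℝ, normF F (fun i => x i - u) := by
    intro y hy
    have : (∑ i, y i * x i) / 2 ≤ ⨅ u : ℝ, normF F (fun i => x i - u) :=
      le_ciInf fun u => by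
        have := pair_le F hmono h0 y hy x u
        linarith
    linarith
  have hbd : BddAbove {r | ∃ y ∈ basePolytope (fun S => min (F S) (F Sᶜ)),
      r = ∑ i, y i * x i} := ⟨_, by rintro _ ⟨y, hy, rfl⟩; exact hup y hy⟩
  constructor
  · rcases isEmpty_or_nonempty V with hV | hV
    · refine (ciInf_le hbb 0).trans ?_
      have h1 : normF F (fun i => x i - 0) ≤ 0 := by
        refine csSup_le (hne _) ?_
        rintro _ ⟨y, _, rfl⟩
        simp
      refine h1.trans (Real.sSup_nonneg ?_)
      rintro _ ⟨y, _, rfl⟩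
      simp
    · obtain ⟨y, hy, u, hu⟩ := key F hsub hmono h0 hpos x
      refine (ciInf_le hbb u).trans ?_
      refine le_trans (csSup_le (hne _) ?_) (le_csSup hbd ⟨y, hy, rfl⟩)
      rintro _ ⟨z, hz, rfl⟩
      exact hu z hz
  · refine Real.sSup_le ?_ (mul_nonneg (by norm_num) (Real.iInf_nonneg fun u => hnn _))
    rintro _ ⟨y, hy, rfl⟩
    exact hup y hy
end

section
/- Let G = (V, E_G, w^G, μ) be a weighted submodular hypergraph whose cut functions δ_h are monotone submodular cut functions, and let H = (V, E_H, w^H) be a weighted graph with H ≼_ρ G. Then for every S ⊆ V, δ_H(S) ≤ ρ · δ_G(S), where δ_H(S) = ∑_{{i,j}∈E_H} w^H_{ij} |1_S(i) − 1_S(j)| and δ_G(S) = ∑_{h∈E_G} w^G_h δ_h(S ∩ h). -/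
open Finset

/-- Membership in the symmetric submodular polyhedron `P_sym(F_h)` of the
non-decreasing submodular function `F` on subsets of the hyperedge `h`,
for vectors of `ℝ^V` supported on `h`. -/
def memSymPolyOn {V : Type*} [Fintype V] [DecidableEq V]
    (h : Finset V) (F : Finset V → ℝ) (y : V → ℝ) : Prop :=
  (∀ i, i ∉ h → y i = 0) ∧ ∀ S ⊆ h, (∑ i ∈ S, |y i|) ≤ F S

/-- The dual norm `‖z‖_{*,F_h} = min {λ ≥ 0 : z ∈ λ·P_sym(F_h)}`. -/
noncomputable def dualNormFOn {V : Type*} [Fintype V] [DecidableEq V]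
    (h : Finset V) (F : Finset V → ℝ) (z : V → ℝ) : ℝ :=
  sInf {l : ℝ | 0 ≤ l ∧ ∀ S ⊆ h, (∑ i ∈ S, |z i|) ≤ l * F S}

/-- If the weighted graph `H` embeds as a flow with congestion `ρ`
into the weighted submodular hypergraph `G` with monotone submodular cut functions
`δ_h(S) = min (F_h S) (F_h (h \ S))`, then `δ_H(S) ≤ ρ · δ_G(S)` for every `S ⊆ V`. -/
theorem flow_embedding_cut_lower_bound
    {V E EH : Type*} [Fintype V] [DecidableEq V] [Fintype E] [Fintype EH]
    (hyper : E → Finset V) (wG : E → ℝ) (μ : V → ℝ) (F : E → Finset V → ℝ)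
    (hwG : ∀ e, 0 < wG e) (hμ : ∀ i, 0 ≤ μ i)
    (hsub : ∀ e, ∀ A B : Finset V, A ⊆ hyper e → B ⊆ hyper e →
      F e (A ∪ B) + F e (A ∩ B) ≤ F e A + F e B)
    (hmono : ∀ e, ∀ A B : Finset V, A ⊆ B → B ⊆ hyper e → F e A ≤ F e B)
    (hF0 : ∀ e, F e ∅ = 0)
    (hFi : ∀ e, ∀ i ∈ hyper e, 0 < F e {i})
    (a b : EH → V) (wH : EH → ℝ) (hwH : ∀ f, 0 ≤ wH f)
    (ρ : ℝ)
    -- the flows `Y f` witnessing the embedding `H ≼_ρ G`: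
    (Y : EH → E → V → ℝ)
    (hsupp : ∀ f e i, i ∉ hyper e → Y f e i = 0)
    (hcons : ∀ f e, (∑ i, Y f e i) = 0)
    (hdem : ∀ f i, |∑ e, Y f e i| =
      wH f * ((if a f = i then (1 : ℝ) else 0) + (if b f = i then 1 else 0)))
    (hcong : ∀ e, dualNormFOn (hyper e) (F e) (fun i => ∑ f, |Y f e i|) ≤ ρ * wG e) :
    ∀ S : Finset V,
      (∑ f, wH f * |(if a f ∈ S then (1 : ℝ) else 0) - (if b f ∈ S then 1 else 0)|) ≤
        ρ * ∑ e, wG e * min (F e (S ∩ hyper e)) (F e (hyper e \ S)) := by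
  intro S
  -- the congestion bound is attained on every subset of the hyperedge
  have key : ∀ e, ∀ T ⊆ hyper e, (∑ f, ∑ i ∈ T, |Y f e i|) ≤ ρ * wG e * F e T := by
    intro e T hT
    have hpos : ∀ T ⊆ hyper e, T.Nonempty → 0 < F e T := by
      rintro T hT ⟨i, hi⟩
      exact (hFi e i (hT hi)).trans_le
        (hmono e _ _ (Finset.singleton_subset_iff.2 hi) hT)
    rcases T.eq_empty_or_nonempty with rfl | hne
    · simp [hF0]
    have hF := hpos T hT hne
    rw [← div_le_iff₀ hF]
    refine le_trans ?_ (hcong e)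
    unfold dualNormFOn
    apply le_csInf
    · refine ⟨∑ S ∈ (hyper e).powerset,
        (∑ i ∈ S, |(∑ f, |Y f e i|)|) / F e S, ?_, ?_⟩
      · apply Finset.sum_nonneg
        intro S hS
        rcases S.eq_empty_or_nonempty with rfl | hne
        · simp
        · exact div_nonneg (Finset.sum_nonneg fun _ _ => abs_nonneg _)
            (hpos S (Finset.mem_powerset.1 hS) hne).le
      · intro S hS
        rcases S.eq_empty_or_nonempty with rfl | hne
        · simp [hF0]
        rw [← div_le_iff₀ (hpos S hS hne)]
        refine Finset.single_le_sum
          (f := fun S => (∑ i ∈ S, |(∑ f, |Y f e i|)|) / F e S) ?_ (Finset.mem_powerset.2 hS)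
        intro S hS
        rcases S.eq_empty_or_nonempty with rfl | hne
        · simp
        · exact div_nonneg (Finset.sum_nonneg fun _ _ => abs_nonneg _)
            (hpos S (Finset.mem_powerset.1 hS) hne).le
    · rintro l ⟨_, hl⟩
      rw [div_le_iff₀ hF]
      refine le_trans (le_of_eq ?_) (hl T hT)
      rw [Finset.sum_comm]
      refine Finset.sum_congr rfl fun i _ => ?_
      exact (abs_of_nonneg (Finset.sum_nonneg fun _ _ => abs_nonneg _)).symm
  have hc1 : ∀ f e, |∑ i ∈ S, Y f e i| ≤ ∑ i ∈ S ∩ hyper e, |Y f e i| := by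
    intro f e
    have : ∑ i ∈ S ∩ hyper e, Y f e i = ∑ i ∈ S, Y f e i := by
      apply Finset.sum_subset Finset.inter_subset_left
      intro i hi hn
      exact hsupp f e i fun h => hn (Finset.mem_inter.2 ⟨hi, h⟩)
    rw [← this]
    exact Finset.abs_sum_le_sum_abs _ _
  have hc2 : ∀ f e, |∑ i ∈ S, Y f e i| ≤ ∑ i ∈ hyper e \ S, |Y f e i| := by
    intro f e
    have h1 : ∑ i ∈ hyper e \ S, Y f e i = ∑ i ∈ Sᶜ, Y f e i := by
      apply Finset.sum_subset
      · intro i hi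
        simp at hi ⊢
        exact hi.2
      intro i hi hn
      refine hsupp f e i fun h => hn (Finset.mem_sdiff.2 ⟨h, Finset.mem_compl.1 hi⟩)
    have h2 := Finset.sum_add_sum_compl S (fun i => Y f e i)
    rw [hcons f e] at h2
    rw [eq_neg_of_add_eq_zero_left h2, abs_neg, ← h1]
    exact Finset.abs_sum_le_sum_abs _ _
  have hedge : ∀ f, wH f * |(if a f ∈ S then (1 : ℝ) else 0) - (if b f ∈ S then 1 else 0)|
      ≤ ∑ e, |∑ i ∈ S, Y f e i| := by
    intro f
    have hnn : 0 ≤ ∑ e, |∑ i ∈ S, Y f e i| := Finset.sum_nonneg fun _ _ => abs_nonneg _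
    have hle : |∑ i ∈ S, ∑ e, Y f e i| ≤ ∑ e, |∑ i ∈ S, Y f e i| := by
      rw [Finset.sum_comm]
      exact Finset.abs_sum_le_sum_abs _ _
    have hone : ∀ u v : V, (∀ i, |∑ e, Y f e i| =
        wH f * ((if u = i then (1 : ℝ) else 0) + (if v = i then 1 else 0))) →
        u ∈ S → v ∉ S → wH f ≤ ∑ e, |∑ i ∈ S, Y f e i| := by
      intro u v hd hu hv
      refine le_trans (le_of_eq ?_) hle
      rw [Finset.sum_eq_single_of_mem u hu, hd u]
      · have : v ≠ u := fun h => hv (h ▸ hu)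
        simp [this]
      · intro i hi hne
        have h := hd i
        have hvi : v ≠ i := fun h => hv (h ▸ hi)
        simpa [hne.symm, hvi] using h
    by_cases ha : a f ∈ S <;> by_cases hb : b f ∈ S
    · simpa [ha, hb] using hnn
    · simpa [ha, hb] using hone _ _ (hdem f) ha hb
    · simpa [ha, hb] using hone (b f) (a f) (fun i => by rw [hdem f i, add_comm]) hb ha
    · simpa [ha, hb] using hnn
  calc _ ≤ ∑ f, ∑ e, |∑ i ∈ S, Y f e i| := Finset.sum_le_sum fun f _ => hedge f
    _ = ∑ e, ∑ f, |∑ i ∈ S, Y f e i| := Finset.sum_comm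
    _ ≤ ∑ e, ρ * (wG e * min (F e (S ∩ hyper e)) (F e (hyper e \ S))) := by
        refine Finset.sum_le_sum fun e _ => ?_
        rw [← mul_assoc]
        rcases min_choice (F e (S ∩ hyper e)) (F e (hyper e \ S)) with h | h <;> rw [h]
        · exact (Finset.sum_le_sum fun f _ => hc1 f e).trans
            (key e _ Finset.inter_subset_right)
        · exact (Finset.sum_le_sum fun f _ => hc2 f e).trans
            (key e _ Finset.sdiff_subset)
    _ = _ := by rw [Finset.mul_sum]
end

section
/- Let G = (V, E_G, w^G, μ) be a weighted submodular hypergraph whose cut functions are monotone submodular cut functions, and let Y = (y_h)_{h∈E_G} be a hypergraph flow over G with congestion cong_G(Y) = max_{h∈E_G} ‖y_h‖_{*,F_h} / w^G_h. Then there exists a weighted graph H = (V, E_H, w^H) such that: (i) H ≼_{cong_G(Y)} G; (ii) H is bipartite between the vertex sets {i ∈ V : dem_i(Y) ≥ 0} and {i ∈ V : dem_i(Y) < 0}; and (iii) the weighted degree of every vertex i in H equals |dem_i(Y)|. -/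
open Finset

/-- A decomposition of the flow `Y` into pair flows `Z a b` of value `W a b` from `a` to `b`, such
that every vertex of `S` is either never a start or never an end. -/
structure FlowState {V E : Type*} [Fintype V] [DecidableEq V] [Fintype E]
    (hyper : E → Finset V) (Y : E → V → ℝ) (S : Finset V)
    (W : V → V → ℝ) (Z : V → V → E → V → ℝ) : Prop where
  nonneg : ∀ a b, 0 ≤ W a b
  supp : ∀ a b e i, i ∉ hyper e → Z a b e i = 0
  cons : ∀ a b e, ∑ i, Z a b e i = 0
  dem : ∀ a b i, ∑ e, Z a b e i =
    W a b * ((if a = i then (1 : ℝ) else 0) - (if b = i then 1 else 0))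
  bound : ∀ e i, ∑ a, ∑ b, |Z a b e i| ≤ |Y e i|
  deg : ∀ i, ∑ b, W i b - ∑ a, W a i = ∑ e, Y e i
  done : ∀ v ∈ S, (∀ b, W v b = 0) ∨ (∀ a, W a v = 0)

theorem flow_init {V E : Type*} [Fintype V] [DecidableEq V] [Fintype E]
    (hyper : E → Finset V) (Y : E → V → ℝ)
    (hsupp : ∀ e i, i ∉ hyper e → Y e i = 0)
    (hcons : ∀ e, (∑ i, Y e i) = 0) :
    ∃ W Z, FlowState hyper Y ∅ W Z := by
  classical
  -- positive and negative parts
  let p : E → V → ℝ := fun e i => max (Y e i) 0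
  let n : E → V → ℝ := fun e i => max (-Y e i) 0
  let M : E → ℝ := fun e => ∑ i, p e i
  have hp : ∀ e i, 0 ≤ p e i := fun e i => le_max_right _ _
  have hn : ∀ e i, 0 ≤ n e i := fun e i => le_max_right _ _
  have hpn : ∀ e i, p e i - n e i = Y e i := by
    intro e i
    simp only [p, n]
    rcases le_total (Y e i) 0 with h | h
    · rw [max_eq_right h, max_eq_left (by linarith)]; ring
    · rw [max_eq_left h, max_eq_right (by linarith)]; ring
  have hpa : ∀ e i, p e i + n e i = |Y e i| := by
    intro e i
    simp only [p, n]
    rcases le_total (Y e i) 0 with h | h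
    · rw [max_eq_right h, max_eq_left (by linarith), abs_of_nonpos h]; ring
    · rw [max_eq_left h, max_eq_right (by linarith), abs_of_nonneg h]; ring
  have hM : ∀ e, M e = ∑ i, n e i := by
    intro e
    have := hcons e
    simp only [← hpn, Finset.sum_sub_distrib] at this
    simp only [M]; linarith
  have hM0 : ∀ e, 0 ≤ M e := fun e => Finset.sum_nonneg fun i _ => hp e i
  have hMp : ∀ e i, p e i * (M e * (M e)⁻¹) = p e i := by
    intro e i
    by_cases h : M e = 0
    · have : p e i = 0 :=
        (Finset.sum_eq_zero_iff_of_nonneg (fun i _ => hp e i)).1 h i (Finset.mem_univ _)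
      simp [this]
    · rw [mul_inv_cancel₀ h, mul_one]
  have hMn : ∀ e i, n e i * (M e * (M e)⁻¹) = n e i := by
    intro e i
    by_cases h : M e = 0
    · have : n e i = 0 :=
        (Finset.sum_eq_zero_iff_of_nonneg (fun i _ => hn e i)).1 ((hM e).symm.trans h) i
          (Finset.mem_univ _)
      simp [this]
    · rw [mul_inv_cancel₀ h, mul_one]
  let x : E → V → V → ℝ := fun e a b => p e a * n e b * (M e)⁻¹
  have hx : ∀ e a b, 0 ≤ x e a b := fun e a b =>
    mul_nonneg (mul_nonneg (hp _ _) (hn _ _)) (inv_nonneg.2 (hM0 e))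
  have hxr : ∀ e a, ∑ b, x e a b = p e a := by
    intro e a
    simp only [x]
    rw [← Finset.sum_mul, ← Finset.mul_sum, ← hM, mul_assoc, hMp]
  have hxc : ∀ e b, ∑ a, x e a b = n e b := by
    intro e b
    simp only [x]
    rw [← Finset.sum_mul, ← Finset.sum_mul, mul_comm (∑ i, p e i), mul_assoc]
    exact hMn e b
  refine ⟨fun a b => ∑ e, x e a b, fun a b e i =>
    x e a b * ((if a = i then (1 : ℝ) else 0) - (if b = i then 1 else 0)), ?_, ?_, ?_, ?_, ?_, ?_, ?_⟩
  · exact fun a b => Finset.sum_nonneg fun e _ => hx e a b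
  · intro a b e i hi
    have h0 := hsupp e i hi
    by_cases ha : a = i
    · subst ha; simp [x, p, h0]
    · by_cases hb : b = i
      · subst hb; simp [x, n, h0]
      · simp [ha, hb]
  · intro a b e
    rw [← Finset.mul_sum, Finset.sum_sub_distrib]; simp
  · intro a b i
    rw [Finset.sum_mul]
  · intro e i
    rw [← hpa, ← hxr, ← hxc]
    calc _ ≤ ∑ a, ∑ b, (x e a b * (if a = i then (1 : ℝ) else 0) +
              x e a b * (if b = i then 1 else 0)) := by
          refine Finset.sum_le_sum fun a _ => Finset.sum_le_sum fun b _ => ?_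
          rw [abs_mul, abs_of_nonneg (hx e a b), ← mul_add]
          refine mul_le_mul_of_nonneg_left ?_ (hx e a b)
          split_ifs <;> norm_num
      _ = _ := by
          simp [Finset.sum_add_distrib]
  · intro i
    rw [Finset.sum_comm, Finset.sum_comm (s := (univ : Finset V))]
    simp only [hxr, hxc, ← hpn, Finset.sum_sub_distrib]
  · simp

theorem flow_step {V E : Type*} [Fintype V] [DecidableEq V] [Fintype E]
    (hyper : E → Finset V) (Y : E → V → ℝ) (S : Finset V) (v : V)
    (W : V → V → ℝ) (Z : V → V → E → V → ℝ) (h : FlowState hyper Y S W Z) :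
    ∃ W' Z', FlowState hyper Y (insert v S) W' Z' := by
  classical
  obtain ⟨K, hK⟩ : ∃ K : Finset V, K = univ.erase v := ⟨_, rfl⟩
  have hKv : ∀ a ∈ K, a ≠ v := by intro a ha; subst hK; exact Finset.ne_of_mem_erase ha
  have split : ∀ f : V → ℝ, ∑ a, f a = f v + ∑ a ∈ K, f a := by
    intro f; rw [hK, Finset.add_sum_erase _ _ (Finset.mem_univ v)]
  obtain ⟨O, hO⟩ : ∃ O, O = ∑ b ∈ K, W v b := ⟨_, rfl⟩
  obtain ⟨I, hI⟩ : ∃ I, I = ∑ a ∈ K, W a v := ⟨_, rfl⟩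
  have hO0 : 0 ≤ O := hO ▸ Finset.sum_nonneg fun b _ => h.nonneg _ _
  have hI0 : 0 ≤ I := hI ▸ Finset.sum_nonneg fun b _ => h.nonneg _ _
  have hOz : O = 0 → ∀ b ∈ K, W v b = 0 := fun h0 =>
    (Finset.sum_eq_zero_iff_of_nonneg (fun b _ => h.nonneg v b)).1 (hO.symm.trans h0)
  have hIz : I = 0 → ∀ b ∈ K, W b v = 0 := fun h0 =>
    (Finset.sum_eq_zero_iff_of_nonneg (fun b _ => h.nonneg b v)).1 (hI.symm.trans h0)
  obtain ⟨m, hm0, hOm, hIm, hdone⟩ : ∃ m : ℝ, 0 ≤ m ∧ O * m ≤ 1 ∧ I * m ≤ 1 ∧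
      ((∀ b ∈ K, (1 - I * m) * W v b = 0) ∨ (∀ a ∈ K, (1 - O * m) * W a v = 0)) := by
    rcases hO0.eq_or_lt with h0 | hpos
    · rcases hI0.eq_or_lt with h1 | h1
      · exact ⟨0, le_rfl, by simp, by simp, Or.inl fun b hb => by simp [hOz h0.symm b hb]⟩
      · refine ⟨I⁻¹, (inv_pos.2 h1).le, by simp [← h0], by simp [h1.ne'], Or.inl fun b hb => ?_⟩
        simp [h1.ne']
    · rcases le_total O I with hle | hle
      · have h1 : 0 < I := hpos.trans_le hle
        refine ⟨I⁻¹, (inv_pos.2 h1).le, ?_, by simp [h1.ne'], Or.inl fun b hb => by simp [h1.ne']⟩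
        rw [← div_eq_mul_inv]; exact (div_le_one h1).2 hle
      · refine ⟨O⁻¹, (inv_pos.2 hpos).le, by simp [hpos.ne'], ?_,
          Or.inr fun b hb => by simp [hpos.ne']⟩
        rw [← div_eq_mul_inv]; exact (div_le_one hpos).2 hle
  have hα : 0 ≤ 1 - O * m := by linarith
  have hβ : 0 ≤ 1 - I * m := by linarith
  let W' : V → V → ℝ := fun a b =>
    if a = v then (if b = v then 0 else (1 - I * m) * W v b)
    else if b = v then (1 - O * m) * W a v else W a b + W a v * W v b * m
  let Z' : V → V → E → V → ℝ := fun a b e i =>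
    if a = v then (if b = v then 0 else (1 - I * m) * Z v b e i)
    else if b = v then (1 - O * m) * Z a v e i
    else Z a b e i + (W v b * m) * Z a v e i + (W a v * m) * Z v b e i
  have W1 : W' v v = 0 := by simp [W']
  have W2 : ∀ b, b ≠ v → W' v b = (1 - I * m) * W v b := by intro b hb; simp [W', hb]
  have W3 : ∀ a, a ≠ v → W' a v = (1 - O * m) * W a v := by intro b hb; simp [W', hb]
  have W4 : ∀ a b, a ≠ v → b ≠ v → W' a b = W a b + W a v * W v b * m := by
    intro a b ha hb; simp [W', ha, hb]
  have Z1 : Z' v v = fun e i => 0 := by funext e i; simp [Z']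
  have Z2 : ∀ b, b ≠ v → Z' v b = fun e i => (1 - I * m) * Z v b e i := by
    intro b hb; funext e i; simp [Z', hb]
  have Z3 : ∀ a, a ≠ v → Z' a v = fun e i => (1 - O * m) * Z a v e i := by
    intro b hb; funext e i; simp [Z', hb]
  have Z4 : ∀ a b, a ≠ v → b ≠ v → Z' a b = fun e i =>
      Z a b e i + (W v b * m) * Z a v e i + (W a v * m) * Z v b e i := by
    intro a b ha hb; funext e i; simp [Z', ha, hb]
  have cases4 : ∀ P : V → V → Prop, P v v → (∀ b, b ≠ v → P v b) → (∀ a, a ≠ v → P a v) →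
      (∀ a b, a ≠ v → b ≠ v → P a b) → ∀ a b, P a b := by
    intro P h1 h2 h3 h4 a b
    by_cases ha : a = v
    · subst ha
      by_cases hb : b = a
      · subst hb; exact h1
      · exact h2 b hb
    · by_cases hb : b = v
      · subst hb; exact h3 a ha
      · exact h4 a b ha hb
  clear_value W' Z'
  refine ⟨W', Z', ?_, ?_, ?_, ?_, ?_, ?_, ?_⟩
  · refine cases4 _ W1.ge ?_ ?_ ?_
    · intro b hb; rw [W2 b hb]; exact mul_nonneg hβ (h.nonneg _ _)
    · intro b hb; rw [W3 b hb]; exact mul_nonneg hα (h.nonneg _ _)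
    · intro a b ha hb; rw [W4 a b ha hb]
      exact add_nonneg (h.nonneg _ _) (mul_nonneg (mul_nonneg (h.nonneg _ _) (h.nonneg _ _)) hm0)
  · refine cases4 _ ?_ ?_ ?_ ?_
    · intro e i hi; rw [Z1]
    · intro b hb e i hi; rw [Z2 b hb]; simp [h.supp _ _ e i hi]
    · intro b hb e i hi; rw [Z3 b hb]; simp [h.supp _ _ e i hi]
    · intro a b ha hb e i hi; rw [Z4 a b ha hb]; simp [h.supp _ _ e i hi]
  · refine cases4 _ ?_ ?_ ?_ ?_
    · intro e; rw [Z1]; simp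
    · intro b hb e; rw [Z2 b hb]; simp only [← Finset.mul_sum, h.cons, mul_zero]
    · intro b hb e; rw [Z3 b hb]; simp only [← Finset.mul_sum, h.cons, mul_zero]
    · intro a b ha hb e; rw [Z4 a b ha hb]
      simp only [Finset.sum_add_distrib, ← Finset.mul_sum, h.cons, mul_zero, add_zero]
  · refine cases4 _ ?_ ?_ ?_ ?_
    · intro i; rw [Z1]; simp
    · intro b hb i; rw [Z2 b hb, W2 b hb]; simp only [← Finset.mul_sum, h.dem]; ring
    · intro b hb i; rw [Z3 b hb, W3 b hb]; simp only [← Finset.mul_sum, h.dem]; ring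
    · intro a b ha hb i; rw [Z4 a b ha hb, W4 a b ha hb]
      simp only [Finset.sum_add_distrib, ← Finset.mul_sum, h.dem]; ring
  · intro e i
    refine le_trans ?_ (h.bound e i)
    simp only [split]
    have e1 : ∑ b ∈ K, |Z' v b e i| = (1 - I * m) * ∑ b ∈ K, |Z v b e i| := by
      rw [Finset.mul_sum]
      refine Finset.sum_congr rfl fun b hb => ?_
      rw [Z2 b (hKv b hb)]; simp only [abs_mul, abs_of_nonneg hβ]
    have e2 : ∑ a ∈ K, |Z' a v e i| = (1 - O * m) * ∑ a ∈ K, |Z a v e i| := by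
      rw [Finset.mul_sum]
      refine Finset.sum_congr rfl fun b hb => ?_
      rw [Z3 b (hKv b hb)]; simp only [abs_mul, abs_of_nonneg hα]
    have e3 : ∑ a ∈ K, ∑ b ∈ K, |Z' a b e i| ≤ ∑ a ∈ K, ∑ b ∈ K, |Z a b e i|
        + O * m * ∑ a ∈ K, |Z a v e i| + I * m * ∑ b ∈ K, |Z v b e i| := by
      have : ∑ a ∈ K, ∑ b ∈ K, |Z a b e i|
        + O * m * ∑ a ∈ K, |Z a v e i| + I * m * ∑ b ∈ K, |Z v b e i| =
        ∑ a ∈ K, ∑ b ∈ K, (|Z a b e i| + (W v b * m) * |Z a v e i| + (W a v * m) * |Z v b e i|) := by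
        simp only [Finset.sum_add_distrib, ← Finset.mul_sum, ← Finset.sum_mul, ← hO, ← hI]
      rw [this]
      refine Finset.sum_le_sum fun a ha => Finset.sum_le_sum fun b hb => ?_
      rw [Z4 a b (hKv a ha) (hKv b hb)]
      refine (abs_add_three _ _ _).trans ?_
      rw [abs_mul (W v b * m), abs_mul (W a v * m), abs_of_nonneg (mul_nonneg (h.nonneg v b) hm0),
        abs_of_nonneg (mul_nonneg (h.nonneg a v) hm0)]
    have e0 : |Z' v v e i| = 0 := by rw [Z1]; simp
    have := abs_nonneg (Z v v e i)
    rw [Finset.sum_add_distrib, Finset.sum_add_distrib, e0, e1, e2]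
    linarith
  · intro i
    rw [← h.deg i]
    simp only [split]
    by_cases hi : i = v
    · subst hi
      have e1 : ∑ b ∈ K, W' i b = (1 - I * m) * O := by
        rw [hO, Finset.mul_sum]
        exact Finset.sum_congr rfl fun b hb => W2 b (hKv b hb)
      have e2 : ∑ b ∈ K, W' b i = (1 - O * m) * I := by
        rw [hI, Finset.mul_sum]
        exact Finset.sum_congr rfl fun b hb => W3 b (hKv b hb)
      rw [e1, e2, ← hO, ← hI]; ring
    · have e1 : ∑ b ∈ K, W' i b = ∑ b ∈ K, W i b + W i v * O * m := by
        rw [hO, Finset.mul_sum, Finset.sum_mul, ← Finset.sum_add_distrib]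
        exact Finset.sum_congr rfl fun b hb => W4 i b hi (hKv b hb)
      have e2 : ∑ b ∈ K, W' b i = ∑ b ∈ K, W b i + I * W v i * m := by
        rw [hI, Finset.sum_mul, Finset.sum_mul, ← Finset.sum_add_distrib]
        exact Finset.sum_congr rfl fun b hb => W4 b i (hKv b hb) hi
      rw [e1, e2, W2 i hi, W3 i hi]; ring
  · intro u hu
    have memK : ∀ b, b ≠ v → b ∈ K := by intro b hb; rw [hK]; simp [hb]
    by_cases huv : u = v
    · subst huv
      rcases hdone with hd | hd
      · left; intro b
        by_cases hb : b = u
        · rw [hb, W1]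
        · rw [W2 b hb, hd b (memK b hb)]
      · right; intro b
        by_cases hb : b = u
        · rw [hb, W1]
        · rw [W3 b hb, hd b (memK b hb)]
    · rcases h.done u ((Finset.mem_insert.1 hu).resolve_left huv) with hd | hd
      · left; intro b
        by_cases hb : b = v
        · rw [hb, W3 u huv, hd]; simp
        · rw [W4 u b huv hb, hd, hd]; simp
      · right; intro b
        by_cases hb : b = v
        · rw [hb, W2 u huv, hd]; simp
        · rw [W4 b u hb huv, hd, hd]; simp

theorem flow_all {V E : Type*} [Fintype V] [DecidableEq V] [Fintype E]
    (hyper : E → Finset V) (Y : E → V → ℝ)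
    (hsupp : ∀ e i, i ∉ hyper e → Y e i = 0)
    (hcons : ∀ e, (∑ i, Y e i) = 0) (S : Finset V) :
    ∃ W Z, FlowState hyper Y S W Z := by
  induction S using Finset.induction_on with
  | empty => exact flow_init hyper Y hsupp hcons
  | insert v S _ ih =>
    obtain ⟨W, Z, h⟩ := ih
    exact flow_step hyper Y S v W Z h

theorem dualNorm_mono {V : Type*} [Fintype V] [DecidableEq V]
    (h : Finset V) (F : Finset V → ℝ)
    (hmono : ∀ A B : Finset V, A ⊆ B → B ⊆ h → F A ≤ F B)
    (hF0 : F ∅ = 0) (hFi : ∀ i ∈ h, 0 < F {i}) (z y : V → ℝ)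
    (hzy : ∀ i, |z i| ≤ |y i|) : dualNormFOn h F z ≤ dualNormFOn h F y := by
  unfold dualNormFOn
  refine csInf_le_csInf ⟨0, fun l hl => hl.1⟩ ?_ ?_
  · refine ⟨∑ i ∈ h, |y i| / F {i}, Finset.sum_nonneg fun i hi =>
      div_nonneg (abs_nonneg _) (hFi i hi).le, fun S hS => ?_⟩
    have h0 : 0 ≤ F S := hF0 ▸ hmono ∅ S (Finset.empty_subset _) hS
    calc ∑ i ∈ S, |y i| ≤ ∑ i ∈ S, |y i| / F {i} * F S := by
          refine Finset.sum_le_sum fun i hi => ?_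
          have hp := hFi i (hS hi)
          rw [div_mul_eq_mul_div, le_div_iff₀ hp]
          exact mul_le_mul_of_nonneg_left
            (hmono _ _ (Finset.singleton_subset_iff.2 hi) hS) (abs_nonneg _)
      _ = (∑ i ∈ S, |y i| / F {i}) * F S := by rw [Finset.sum_mul]
      _ ≤ _ := by
          refine mul_le_mul_of_nonneg_right ?_ h0
          exact Finset.sum_le_sum_of_subset_of_nonneg hS fun i hi _ =>
            div_nonneg (abs_nonneg _) (hFi i hi).le
  · rintro l ⟨h0, hl⟩
    exact ⟨h0, fun S hS => (Finset.sum_le_sum fun i _ => hzy i).trans (hl S hS)⟩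

/-- hypergraph flow decomposition. Given a hypergraph flow `Y` over a
weighted submodular hypergraph `G` with monotone submodular cut functions, there is a
weighted (multi)graph `H` (edges indexed by `Fin k`, endpoints `a f, b f`, weights
`wH f > 0`) such that (i) `H ≼_{cong_G(Y)} G`, where
`cong_G(Y) = max_h ‖y_h‖_{*,F_h} / wG_h`;
(ii) `H` is bipartite between `{i : dem_i(Y) ≥ 0}` and `{i : dem_i(Y) < 0}`; and
(iii) the weighted degree of every vertex `i` in `H` equals `|dem_i(Y)|`. -/
theorem hypergraph_flow_decomposition
    {V E : Type*} [Fintype V] [DecidableEq V] [Fintype E] [Nonempty E]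
    (hyper : E → Finset V) (wG : E → ℝ) (μ : V → ℝ) (F : E → Finset V → ℝ)
    (hwG : ∀ e, 0 < wG e) (hμ : ∀ i, 0 ≤ μ i)
    (hsub : ∀ e, ∀ A B : Finset V, A ⊆ hyper e → B ⊆ hyper e →
      F e (A ∪ B) + F e (A ∩ B) ≤ F e A + F e B)
    (hmono : ∀ e, ∀ A B : Finset V, A ⊆ B → B ⊆ hyper e → F e A ≤ F e B)
    (hF0 : ∀ e, F e ∅ = 0)
    (hFi : ∀ e, ∀ i ∈ hyper e, 0 < F e {i})
    -- the hypergraph flow `Y` over `G`: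
    (Y : E → V → ℝ)
    (hsupp : ∀ e i, i ∉ hyper e → Y e i = 0)
    (hcons : ∀ e, (∑ i, Y e i) = 0) :
    ∃ (k : ℕ) (a b : Fin k → V) (wH : Fin k → ℝ),
      (∀ f, 0 < wH f) ∧
      -- (i) `H ≼_{cong_G(Y)} G`, witnessed by the flows `Z f`:
      (∃ Z : Fin k → E → V → ℝ,
        (∀ f e i, i ∉ hyper e → Z f e i = 0) ∧
        (∀ f e, (∑ i, Z f e i) = 0) ∧
        (∀ f i, |∑ e, Z f e i| =
          wH f * ((if a f = i then (1 : ℝ) else 0) + (if b f = i then 1 else 0))) ∧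
        (∀ e, dualNormFOn (hyper e) (F e) (fun i => ∑ f, |Z f e i|) ≤
          (⨆ e' : E, dualNormFOn (hyper e') (F e') (Y e') / wG e') * wG e)) ∧
      -- (ii) bipartiteness between the non-negative- and negative-demand vertices:
      (∀ f, 0 ≤ (∑ e, Y e (a f)) ∧ (∑ e, Y e (b f)) < 0) ∧
      -- (iii) weighted degrees equal the absolute demands:
      (∀ i : V,
        (∑ f, ((if a f = i then wH f else 0) + (if b f = i then wH f else 0))) =
          |∑ e, Y e i|) := by
  classical
  obtain ⟨W, Z, h⟩ := flow_all hyper Y hsupp hcons univ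
  let T := {q : V × V // 0 < W q.1 q.2}
  let g : Fin (Fintype.card T) ≃ T := (Fintype.equivFin T).symm
  -- sums over the edges are sums over pairs
  have hsum : ∀ φ : V → V → ℝ, ∑ f, φ (g f).1.1 (g f).1.2 =
      ∑ a, ∑ b, if 0 < W a b then φ a b else 0 := by
    intro φ
    rw [g.sum_comp (fun t : T => φ t.1.1 t.1.2), ← Fintype.sum_prod_type'
      (f := fun a b => if 0 < W a b then φ a b else 0), ← Finset.sum_filter]
    exact (Finset.sum_subtype _ (by simp) (fun q : V × V => φ q.1 q.2)).symm
  have hout : ∀ a b, 0 < W a b → ∀ c, W c a = 0 := by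
    intro a b hab
    rcases h.done a (Finset.mem_univ _) with hd | hd
    · exact absurd (hd b) hab.ne'
    · exact hd
  have hin : ∀ a b, 0 < W a b → ∀ c, W b c = 0 := by
    intro a b hab
    rcases h.done b (Finset.mem_univ _) with hd | hd
    · exact hd
    · exact absurd (hd a) hab.ne'
  refine ⟨Fintype.card T, fun f => (g f).1.1, fun f => (g f).1.2,
    fun f => W (g f).1.1 (g f).1.2, fun f => (g f).2,
    ⟨fun f => Z (g f).1.1 (g f).1.2, fun f => h.supp _ _, fun f => h.cons _ _, ?_, ?_⟩, ?_, ?_⟩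
  · intro f i
    rw [h.dem, abs_mul, abs_of_nonneg (h.nonneg _ _)]
    have hne : (g f).1.1 ≠ (g f).1.2 := by
      intro heq
      have h1 := (g f).2
      have h2 := hout _ _ h1 (g f).1.1
      rw [← heq] at h1
      exact h1.ne' h2
    congr 1
    by_cases h1 : (g f).1.1 = i
    · have h2 : (g f).1.2 ≠ i := fun h2 => hne (h1.trans h2.symm)
      simp [h1, h2]
    · simp only [h1, if_false]
      split_ifs <;> simp
  · intro e
    have h1 : dualNormFOn (hyper e) (F e) (Y e) / wG e ≤
        ⨆ e' : E, dualNormFOn (hyper e') (F e') (Y e') / wG e' :=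
      le_ciSup (f := fun e' : E => dualNormFOn (hyper e') (F e') (Y e') / wG e')
        (Set.finite_range _).bddAbove e
    refine le_trans ?_ ((div_le_iff₀ (hwG e)).1 h1)
    refine dualNorm_mono _ _ (hmono e) (hF0 e) (hFi e) _ _ fun i => ?_
    rw [abs_of_nonneg (Finset.sum_nonneg fun f _ => abs_nonneg _)]
    refine le_trans ?_ (h.bound e i)
    rw [hsum (fun a b => |Z a b e i|)]
    refine Finset.sum_le_sum fun a _ => Finset.sum_le_sum fun b _ => ?_
    split_ifs
    · exact le_rfl
    · exact abs_nonneg _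
  · intro f
    have hf := (g f).2
    constructor
    · rw [← h.deg, Finset.sum_eq_zero (fun c _ => hout _ _ hf c), sub_zero]
      exact Finset.sum_nonneg fun b _ => h.nonneg _ _
    · rw [← h.deg, Finset.sum_eq_zero (fun c _ => hin _ _ hf c), zero_sub, neg_lt_zero]
      exact Finset.sum_pos' (fun b _ => h.nonneg _ _) ⟨_, Finset.mem_univ _, hf⟩
  · intro i
    rw [hsum (fun a b => (if a = i then W a b else 0) + (if b = i then W a b else 0))]
    have h1 : ∀ a b, (if 0 < W a b then
        ((if a = i then W a b else 0) + (if b = i then W a b else 0)) else 0) =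
        (if a = i then W a b else 0) + (if b = i then W a b else 0) := by
      intro a b
      by_cases hab : 0 < W a b
      · rw [if_pos hab]
      · have : W a b = 0 := le_antisymm (not_lt.1 hab) (h.nonneg a b)
        simp [this]
    simp only [h1, Finset.sum_add_distrib]
    have h2 : ∑ a, ∑ b, (if a = i then W a b else 0) = ∑ b, W i b := by
      rw [Finset.sum_comm]; simp
    have h3 : ∑ a, ∑ b, (if b = i then W a b else 0) = ∑ a, W a i := by simp
    rw [h2, h3, ← h.deg]
    rcases h.done i (Finset.mem_univ _) with hd | hd
    · rw [Finset.sum_eq_zero (fun c _ => hd c), zero_add, zero_sub, abs_neg,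
        abs_of_nonneg (Finset.sum_nonneg fun b _ => h.nonneg _ _)]
    · rw [Finset.sum_eq_zero (s := univ) (f := fun a => W a i) (fun c _ => hd c), add_zero,
        sub_zero, abs_of_nonneg (Finset.sum_nonneg fun b _ => h.nonneg _ _)]
end

section
/- Let G = (V, E, w, μ) be a weighted submodular hypergraph with submodular cut functions δ_h satisfying δ_h(∅) = 0, and let s ∈ ℝ^V with ⟨s, 1⟩_μ = 0, ‖s‖_∞ ≤ 1 and μ∘s ≠ 0. Then strong duality holds for the ratio-cut improvement problem: min{ ∑_{h∈E} w_h · δ̄_h(x) : x ∈ ℝ^V, ⟨s, x⟩_μ = 1 } = max{ α ∈ ℝ : there exist vectors f_h ∈ w_h·B(δ_h) (f_h ∈ ℝ^V supported on h) for each h ∈ E with ∑_{h∈E} f_h = α·(μ ∘ s) }, where ⟨s, x⟩_μ = ∑_i μ_i s_i x_i and μ ∘ s is the coordinatewise product. -/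
open Finset

/-- Membership in the base polytope `B(δ_h)` of the submodular cut function `δ` on
subsets of the hyperedge `h`, for vectors of `ℝ^V` supported on `h`. -/
def memBaseOn {V : Type*} [Fintype V] [DecidableEq V]
    (h : Finset V) (δ : Finset V → ℝ) (y : V → ℝ) : Prop :=
  (∀ i, i ∉ h → y i = 0) ∧ (∑ i ∈ h, y i) = δ h ∧ ∀ S ⊆ h, (∑ i ∈ S, y i) ≤ δ S

/-- The Lovász extension `δ̄_h(x) = max_{y ∈ B(δ_h)} ⟨y, x⟩`. -/
noncomputable def lovaszOn {V : Type*} [Fintype V] [DecidableEq V]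
    (h : Finset V) (δ : Finset V → ℝ) (x : V → ℝ) : ℝ :=
  sSup {r | ∃ y : V → ℝ, memBaseOn h δ y ∧ r = ∑ i, y i * x i}

/-- The base polytope is nonempty (greedy construction). -/
theorem memBaseOn_nonempty {V : Type*} [Fintype V] [DecidableEq V]
    (δ : Finset V → ℝ) (hδ0 : δ ∅ = 0) (h : Finset V) :
    (∀ A B : Finset V, A ⊆ h → B ⊆ h → δ (A ∪ B) + δ (A ∩ B) ≤ δ A + δ B) →
    ∃ y, memBaseOn h δ y := by
  induction h using Finset.induction_on with
  | empty =>
    intro _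
    refine ⟨0, by simp, by simp [hδ0], ?_⟩
    intro S hS
    have : S = ∅ := Finset.subset_empty.mp hS
    subst this
    simp [hδ0]
  | insert a t ha ih =>
    intro hsub
    obtain ⟨y, hy0, hy1, hy2⟩ := ih (fun A B hA hB =>
      hsub A B (hA.trans (Finset.subset_insert _ _)) (hB.trans (Finset.subset_insert _ _)))
    have key : ∀ S : Finset V, a ∉ S →
        ∑ i ∈ S, Function.update y a (δ (insert a t) - δ t) i = ∑ i ∈ S, y i := by
      intro S hS
      refine Finset.sum_congr rfl fun i hi => ?_
      rw [Function.update_of_ne]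
      rintro rfl
      exact hS hi
    refine ⟨Function.update y a (δ (insert a t) - δ t), ?_, ?_, ?_⟩
    · intro i hi
      rw [Finset.mem_insert, not_or] at hi
      rw [Function.update_of_ne hi.1]
      exact hy0 i hi.2
    · rw [Finset.sum_insert ha, key t ha, hy1, Function.update_self]
      ring
    · intro S hS
      by_cases haS : a ∈ S
      · rw [← Finset.add_sum_erase S _ haS, key _ (Finset.notMem_erase a S),
          Function.update_self]
        have hsubt : S.erase a ⊆ t := by
          intro i hi
          rw [Finset.mem_erase] at hi
          exact (Finset.mem_insert.mp (hS hi.2)).resolve_left hi.1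
        have h1 := hy2 _ hsubt
        have h2 := hsub S t hS (Finset.subset_insert _ _)
        have h3 : S ∪ t = insert a t := by
          ext i
          have := @hS i
          simp only [Finset.mem_union, Finset.mem_insert] at this ⊢
          constructor
          · rintro (h | h)
            · exact this h
            · exact Or.inr h
          · rintro (h | h)
            · exact Or.inl (h ▸ haS)
            · exact Or.inr h
        have h4 : S ∩ t = S.erase a := by
          ext i
          simp only [Finset.mem_inter, Finset.mem_erase]
          constructor
          · rintro ⟨h, h'⟩
            exact ⟨fun e => ha (e ▸ h'), h⟩
          · rintro ⟨h, h'⟩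
            exact ⟨h', hsubt (Finset.mem_erase.mpr ⟨h, h'⟩)⟩
        rw [h3, h4] at h2
        linarith
      · rw [key S haS]
        exact hy2 S ((Finset.subset_insert_iff_of_notMem haS).mp hS)

theorem memBaseOn_isCompact {V : Type*} [Fintype V] [DecidableEq V]
    (δ : Finset V → ℝ) (h : Finset V) : IsCompact {y | memBaseOn h δ y} := by
  have hcl : IsClosed {y : V → ℝ | memBaseOn h δ y} := by
    have : {y : V → ℝ | memBaseOn h δ y} =
        (⋂ i, ⋂ (_ : i ∉ h), {y : V → ℝ | y i = 0}) ∩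
        ({y : V → ℝ | ∑ i ∈ h, y i = δ h} ∩
          ⋂ S, ⋂ (_ : S ⊆ h), {y : V → ℝ | ∑ i ∈ S, y i ≤ δ S}) := by
      ext y
      simp [memBaseOn]
    rw [this]
    refine IsClosed.inter ?_ (IsClosed.inter ?_ ?_)
    · exact isClosed_iInter fun i => isClosed_iInter fun _ =>
        isClosed_eq (continuous_apply i) continuous_const
    · exact isClosed_eq (by fun_prop) continuous_const
    · exact isClosed_iInter fun i => isClosed_iInter fun _ =>
        isClosed_le (by fun_prop) continuous_const
  refine IsCompact.of_isClosed_subset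
    (isCompact_Icc (a := fun i => if i ∈ h then δ h - δ (h.erase i) else 0)
      (b := fun i => if i ∈ h then δ {i} else 0)) hcl ?_
  rintro y ⟨h0, h1, h2⟩
  constructor
  · intro i
    by_cases hi : i ∈ h
    · have := h2 _ (Finset.erase_subset i h)
      have h3 := Finset.add_sum_erase h y hi
      simp only [hi, if_true]
      linarith
    · simp [hi, h0 i hi]
  · intro i
    by_cases hi : i ∈ h
    · have := h2 {i} (by simpa using hi)
      simpa [hi] using this
    · simp [hi, h0 i hi]

theorem memBaseOn_convex {V : Type*} [Fintype V] [DecidableEq V]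
    (δ : Finset V → ℝ) (h : Finset V) : Convex ℝ {y | memBaseOn h δ y} := by
  rintro y ⟨y0, y1, y2⟩ z ⟨z0, z1, z2⟩ a b ha hb hab
  refine ⟨?_, ?_, ?_⟩
  · intro i hi
    simp [y0 i hi, z0 i hi]
  · simp only [Pi.add_apply, Pi.smul_apply, smul_eq_mul, Finset.sum_add_distrib,
      ← Finset.mul_sum, y1, z1]
    rw [← add_mul, hab, one_mul]
  · intro S hS
    simp only [Pi.add_apply, Pi.smul_apply, smul_eq_mul, Finset.sum_add_distrib,
      ← Finset.mul_sum]
    calc _ ≤ a * δ S + b * δ S := by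
          gcongr
          · exact y2 S hS
          · exact z2 S hS
      _ = δ S := by rw [← add_mul, hab, one_mul]

/-- The Lovász extension is an attained maximum. -/
theorem lovaszOn_spec {V : Type*} [Fintype V] [DecidableEq V]
    (δ : Finset V → ℝ) (h : Finset V) (hne : ∃ y, memBaseOn h δ y) (x : V → ℝ) :
    (∃ y, memBaseOn h δ y ∧ lovaszOn h δ x = ∑ i, y i * x i) ∧
    ∀ y, memBaseOn h δ y → ∑ i, y i * x i ≤ lovaszOn h δ x := by
  obtain ⟨y, hy, hmax⟩ := (memBaseOn_isCompact δ h).exists_isMaxOn hne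
    (f := fun y : V → ℝ => ∑ i, y i * x i) (by fun_prop)
  have hg : IsGreatest {r | ∃ y : V → ℝ, memBaseOn h δ y ∧ r = ∑ i, y i * x i}
      (∑ i, y i * x i) := by
    refine ⟨⟨y, hy, rfl⟩, ?_⟩
    rintro r ⟨z, hz, rfl⟩
    exact hmax hz
  have he : lovaszOn h δ x = ∑ i, y i * x i := hg.csSup_eq
  refine ⟨⟨y, hy, he⟩, fun z hz => ?_⟩
  rw [he]
  exact hmax hz

/-- Abstract duality for the support function of a compact convex set. -/
theorem support_duality {V : Type*} [Fintype V] [DecidableEq V]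
    (K : Set (V → ℝ)) (hK : IsCompact K) (hKc : Convex ℝ K)
    (σ : (V → ℝ) → ℝ) (hσ1 : ∀ x, ∃ k ∈ K, σ x = ∑ i, k i * x i)
    (hσ2 : ∀ x, ∀ k ∈ K, ∑ i, k i * x i ≤ σ x)
    (b : V → ℝ) (hb : b ≠ 0) :
    sInf {r | ∃ x : V → ℝ, ∑ i, b i * x i = 1 ∧ r = σ x} = sSup {α : ℝ | α • b ∈ K} := by
  obtain ⟨i0, hi0⟩ : ∃ i, b i ≠ 0 := Function.ne_iff.mp hb
  have hx0 : ∑ i, b i * (Pi.single i0 (b i0)⁻¹ : V → ℝ) i = 1 := by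
    simp [Pi.single_apply, hi0]
  have weak : ∀ α : ℝ, α • b ∈ K → ∀ x : V → ℝ, ∑ i, b i * x i = 1 → α ≤ σ x := by
    intro α hα x hx
    have := hσ2 x _ hα
    simp only [Pi.smul_apply, smul_eq_mul, mul_assoc, ← Finset.mul_sum, hx, mul_one] at this
    exact this
  have strong : ∀ β : ℝ, (∀ α : ℝ, α • b ∈ K → α < β) →
      ∃ x : V → ℝ, ∑ i, b i * x i = 1 ∧ σ x < β := by
    intro β hβ
    let R : Set (V → ℝ) := {z | z = (z i0 / b i0) • b ∧ β ≤ z i0 / b i0}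
    have hRc : IsClosed R := by
      refine IsClosed.inter ?_ ?_
      · exact isClosed_eq (f := fun z : V → ℝ => z) (g := fun z => (z i0 / b i0) • b)
          continuous_id (by fun_prop)
      · exact isClosed_le (f := fun _ : V → ℝ => β) (g := fun z => z i0 / b i0)
          continuous_const (by fun_prop)
    have hRmem : ∀ α : ℝ, β ≤ α → α • b ∈ R := by
      intro α hα
      have : (α • b) i0 / b i0 = α := by simp [hi0]
      refine ⟨?_, ?_⟩
      · rw [this]
      · rw [this]; exact hα
    have hRconv : Convex ℝ R := by
      rintro y ⟨y1, y2⟩ z ⟨z1, z2⟩ p q hp hq hpq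
      have e : p • y + q • z = (p * (y i0 / b i0) + q * (z i0 / b i0)) • b := by
        conv_lhs => rw [y1, z1]
        rw [smul_smul, smul_smul, ← add_smul]
      rw [e]
      apply hRmem
      calc β = p * β + q * β := by rw [← add_mul, hpq, one_mul]
        _ ≤ _ := by gcongr
    have hdisj : Disjoint K R := by
      rw [Set.disjoint_left]
      rintro z hzK ⟨hz, hz'⟩
      rw [hz] at hzK
      exact absurd (hβ _ hzK) (not_lt.mpr hz')
    obtain ⟨f, u, v, hfu, huv, hfv⟩ :=
      geometric_hahn_banach_compact_closed hKc hK hRconv hRc hdisj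
    let x : V → ℝ := fun i => f (Pi.single i 1)
    have hf : ∀ z : V → ℝ, f z = ∑ i, z i * x i := by
      intro z
      conv_lhs => rw [pi_eq_sum_univ' z]
      simp [x, map_sum]
    have hσx : σ x < u := by
      obtain ⟨k, hk, e⟩ := hσ1 x
      rw [e, ← hf]
      exact hfu k hk
    have hray : ∀ α : ℝ, β ≤ α → v < α * f b := by
      intro α hα
      have := hfv _ (hRmem α hα)
      simpa using this
    have hc : 0 ≤ f b := by
      by_contra hneg
      push Not at hneg
      have h1 := hray (max β (v / f b)) (le_max_left _ _)
      have h2 : max β (v / f b) * f b ≤ v / f b * f b :=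
        mul_le_mul_of_nonpos_right (le_max_right _ _) hneg.le
      rw [div_mul_cancel₀ _ hneg.ne] at h2
      linarith
    rcases hc.eq_or_lt with hc | hc
    · have hv := hray β le_rfl
      rw [← hc, mul_zero] at hv
      have hneg : σ x < 0 := by linarith
      let x0 : V → ℝ := Pi.single i0 (b i0)⁻¹
      have hsubadd : ∀ t : ℝ, 0 ≤ t → σ (x0 + t • x) ≤ σ x0 + t * σ x := by
        intro t ht
        obtain ⟨k, hk, e⟩ := hσ1 (x0 + t • x)
        rw [e]
        have e2 : ∑ i, k i * (x0 + t • x) i = ∑ i, k i * x0 i + t * ∑ i, k i * x i := by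
          rw [Finset.mul_sum, ← Finset.sum_add_distrib]
          refine Finset.sum_congr rfl fun i _ => ?_
          simp only [Pi.add_apply, Pi.smul_apply, smul_eq_mul]
          ring
        rw [e2]
        exact add_le_add (hσ2 _ _ hk) (mul_le_mul_of_nonneg_left (hσ2 _ _ hk) ht)
      let t : ℝ := (|σ x0 - β| + 1) / (-σ x)
      have ht : 0 ≤ t := div_nonneg (by positivity) (by linarith)
      refine ⟨x0 + t • x, ?_, ?_⟩
      · have e2 : ∑ i, b i * (x0 + t • x) i = ∑ i, b i * x0 i + t * ∑ i, b i * x i := by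
          rw [Finset.mul_sum, ← Finset.sum_add_distrib]
          refine Finset.sum_congr rfl fun i _ => ?_
          simp only [Pi.add_apply, Pi.smul_apply, smul_eq_mul]
          ring
        rw [e2, ← hf b, ← hc, mul_zero, add_zero]
        exact hx0
      · have h1 := hsubadd t ht
        have h2 : t * (-σ x) = |σ x0 - β| + 1 := div_mul_cancel₀ _ (by linarith)
        have h3 := le_abs_self (σ x0 - β)
        linarith
    · refine ⟨(f b)⁻¹ • x, ?_, ?_⟩
      · have : ∑ i, b i * ((f b)⁻¹ • x) i = (f b)⁻¹ * f b := by
          rw [hf b, Finset.mul_sum]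
          refine Finset.sum_congr rfl fun i _ => ?_
          simp only [Pi.smul_apply, smul_eq_mul]
          ring
        rw [this, inv_mul_cancel₀ hc.ne']
      · obtain ⟨k, hk, e⟩ := hσ1 ((f b)⁻¹ • x)
        have e2 : ∑ i, k i * ((f b)⁻¹ • x) i = (f b)⁻¹ * f k := by
          rw [hf k, Finset.mul_sum]
          refine Finset.sum_congr rfl fun i _ => ?_
          simp only [Pi.smul_apply, smul_eq_mul]
          ring
        rw [e, e2, inv_mul_lt_iff₀ hc]
        have h1 := hfu k hk
        have h2 := hray β le_rfl
        linarith
  have hPne : {r | ∃ x : V → ℝ, ∑ i, b i * x i = 1 ∧ r = σ x}.Nonempty := ⟨_, _, hx0, rfl⟩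
  rcases Set.eq_empty_or_nonempty {α : ℝ | α • b ∈ K} with hA | hA
  · rw [hA, Real.sSup_empty]
    apply Real.sInf_of_not_bddBelow
    rintro ⟨m, hm⟩
    obtain ⟨x, hx, hlt⟩ := strong m (fun α hα => by
      have : α ∈ ({α : ℝ | α • b ∈ K} : Set ℝ) := hα
      rw [hA] at this
      exact this.elim)
    exact absurd (hm ⟨x, hx, rfl⟩) (not_le.mpr hlt)
  · have hbddA : BddAbove {α : ℝ | α • b ∈ K} := ⟨_, fun α hα => weak α hα _ hx0⟩
    have hbddP : BddBelow {r | ∃ x : V → ℝ, ∑ i, b i * x i = 1 ∧ r = σ x} := by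
      obtain ⟨α, hα⟩ := hA
      refine ⟨α, ?_⟩
      rintro r ⟨x, hx, rfl⟩
      exact weak α hα x hx
    apply le_antisymm
    · apply le_of_forall_gt_imp_ge_of_dense
      intro β hβ
      obtain ⟨x, hx, hlt⟩ := strong β (fun α hα => (le_csSup hbddA hα).trans_lt hβ)
      exact (csInf_le hbddP ⟨x, hx, rfl⟩).trans hlt.le
    · refine csSup_le hA fun α hα => le_csInf hPne ?_
      rintro r ⟨x, hx, rfl⟩
      exact weak α hα x hx

/-- Strong duality for the ratio-cut improvement problem: for a
weighted submodular hypergraph `G` and a seed `s` with `⟨s, 1⟩_μ = 0`, `‖s‖_∞ ≤ 1`,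
and `μ ∘ s ≠ 0`,
`min {∑_h w_h δ̄_h(x) : ⟨s, x⟩_μ = 1} = max {α : ∃ f_h ∈ w_h·B(δ_h), ∑_h f_h = α·(μ∘s)}`. -/
theorem ratio_cut_improvement_strong_duality
    {V E : Type*} [Fintype V] [DecidableEq V] [Fintype E]
    (hyper : E → Finset V) (w : E → ℝ) (μ : V → ℝ) (δ : E → Finset V → ℝ)
    (hw : ∀ e, 0 < w e) (hμ : ∀ i, 0 ≤ μ i)
    (hsub : ∀ e, ∀ A B : Finset V, A ⊆ hyper e → B ⊆ hyper e →
      δ e (A ∪ B) + δ e (A ∩ B) ≤ δ e A + δ e B)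
    (hδ0 : ∀ e, δ e ∅ = 0)
    (s : V → ℝ)
    (hs0 : (∑ i, μ i * s i) = 0)
    (hsinf : ∀ i, |s i| ≤ 1)
    (hne : (fun i => μ i * s i) ≠ 0) :
    sInf {r | ∃ x : V → ℝ, (∑ i, μ i * s i * x i) = 1 ∧
        r = ∑ e, w e * lovaszOn (hyper e) (δ e) x}
    = sSup {α | ∃ g : E → V → ℝ,
        (∀ e, ∃ y : V → ℝ, memBaseOn (hyper e) (δ e) y ∧ g e = w e • y) ∧
        (∀ i, (∑ e, g e i) = α * (μ i * s i))} := by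
  have hBne : ∀ e, ∃ y, memBaseOn (hyper e) (δ e) y := fun e =>
    memBaseOn_nonempty (δ e) (hδ0 e) (hyper e) (hsub e)
  let P : Set (E → V → ℝ) := Set.univ.pi fun e => {y | memBaseOn (hyper e) (δ e) y}
  let L : (E → V → ℝ) →ₗ[ℝ] (V → ℝ) := ∑ e, w e • LinearMap.proj e
  have hL : ∀ y i, L y i = ∑ e, w e * y e i := by
    intro y i
    simp [L]
  have hP : IsCompact P := isCompact_univ_pi fun e => memBaseOn_isCompact _ _
  have hPc : Convex ℝ P := convex_pi fun e _ => memBaseOn_convex _ _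
  have hLcont : Continuous L := L.continuous_of_finiteDimensional
  have hdot : ∀ (y : E → V → ℝ) (x : V → ℝ),
      ∑ i, L y i * x i = ∑ e, w e * ∑ i, y e i * x i := by
    intro y x
    simp only [hL, Finset.sum_mul, Finset.mul_sum]
    rw [Finset.sum_comm]
    simp only [mul_assoc]
  have main := support_duality (L '' P) (hP.image hLcont) (hPc.linear_image L)
    (fun x => ∑ e, w e * lovaszOn (hyper e) (δ e) x) ?_ ?_ (fun i => μ i * s i) hne
  · rw [main]
    congr 1
    ext α
    simp only [Set.mem_setOf_eq]
    constructor
    · rintro ⟨y, hy, e⟩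
      refine ⟨fun e => w e • y e, fun e => ⟨y e, hy e trivial, rfl⟩, fun i => ?_⟩
      have := congrFun e i
      rw [hL] at this
      simpa using this
    · rintro ⟨g, hg, hsum⟩
      choose y hy hgy using hg
      refine ⟨y, fun e _ => hy e, ?_⟩
      ext i
      rw [hL]
      have := hsum i
      simp only [hgy] at this
      simpa using this
  · intro x
    choose y hy hyx using fun e => (lovaszOn_spec (δ e) (hyper e) (hBne e) x).1
    refine ⟨L y, ⟨y, fun e _ => hy e, rfl⟩, ?_⟩
    rw [hdot]
    simp only [hyx]
  · rintro x _ ⟨y, hy, rfl⟩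
    rw [hdot]
    exact Finset.sum_le_sum fun e _ => mul_le_mul_of_nonneg_left
      ((lovaszOn_spec (δ e) (hyper e) (hBne e) x).2 _ (hy e trivial)) (hw e).le
end

section
/- Let G = (V, E, w, μ) be a weighted submodular hypergraph with submodular cut functions δ_h satisfying δ_h(∅) = δ_h(h) = 0 and δ_h(S) = δ_h(h \ S), with strictly positive vertex weights μ. Then the minimum ratio-cut value equals the minimum of the ratio of Lovász extensions: Ψ_G^* = min{ δ̄_G(x) / δ̄_μ(x) : x ∈ ℝ^V not a constant vector }, where δ̄_G(x) = ∑_{h∈E} w_h δ̄_h(x) and δ̄_μ is the Lovász extension of S ↦ min{μ(S), μ(V \ S)}. -/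
open Finset

/-- Prefix sets of an ordering. -/
def pre {V : Type*} [Fintype V] {n : ℕ} (e : V ≃ Fin n) (k : ℕ) : Finset V :=
  Finset.univ.filter (fun v => (e v : ℕ) < k)

lemma mem_pre {V : Type*} [Fintype V] {n : ℕ} (e : V ≃ Fin n) (k : ℕ) (v : V) :
    v ∈ pre e k ↔ (e v : ℕ) < k := by simp [pre]

lemma tele (a : ℕ → ℝ) (j m : ℕ) (hj : j ≤ m) :
    a j = (∑ k ∈ range m, (a k - a (k+1)) * (if j < k + 1 then 1 else 0)) + a m := by
  induction m, hj using Nat.le_induction with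
  | base =>
    rw [Finset.sum_eq_zero]
    · simp
    · intro k hk
      have := Finset.mem_range.1 hk
      rw [if_neg (by omega)]; simp
  | succ m hm ih =>
    rw [Finset.sum_range_succ, if_pos (by omega)]
    linarith

lemma abel {V : Type*} [Fintype V] {m : ℕ} (e : V ≃ Fin (m+1)) (a : ℕ → ℝ) (y x : V → ℝ)
    (hx : ∀ v, x v = a (e v)) :
    ∑ v, y v * x v = (∑ k ∈ range m, (a k - a (k+1)) * ∑ v ∈ pre e (k+1), y v)
      + a m * ∑ v, y v := by
  have h1 : ∀ v, y v * x v =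
      (∑ k ∈ range m, (a k - a (k+1)) * (if (e v : ℕ) < k + 1 then y v else 0)) + a m * y v := by
    intro v
    rw [hx v, tele a (e v) m (by have := (e v).2; omega), mul_add, Finset.mul_sum, mul_comm (y v) (a m)]
    congr 1
    apply Finset.sum_congr rfl
    intro k _
    split_ifs <;> ring
  rw [Finset.sum_congr rfl (fun v _ => h1 v), Finset.sum_add_distrib, Finset.sum_comm,
    Finset.mul_sum]
  congr 1
  apply Finset.sum_congr rfl
  intro k _
  rw [← Finset.mul_sum, pre, Finset.sum_filter]

lemma pre_succ {V : Type*} [Fintype V] [DecidableEq V] {n : ℕ} (e : V ≃ Fin n) (k : ℕ)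
    (hk : k < n) : pre e (k+1) = insert (e.symm ⟨k, hk⟩) (pre e k) := by
  ext v
  rw [mem_insert, mem_pre, mem_pre, Equiv.eq_symm_apply, Fin.ext_iff]
  simp only
  omega

lemma pre_all {V : Type*} [Fintype V] {n : ℕ} (e : V ≃ Fin n) : pre e n = univ := by
  ext v; simp [mem_pre]

lemma pre_zero {V : Type*} [Fintype V] {n : ℕ} (e : V ≃ Fin n) : pre e 0 = ∅ := by
  ext v; simp [mem_pre]

lemma greedy {V : Type*} [Fintype V] [DecidableEq V] {n : ℕ} (e : V ≃ Fin n)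
    (h : Finset V) (F : Finset V → ℝ)
    (hsub : ∀ A B : Finset V, A ⊆ h → B ⊆ h → F (A ∪ B) + F (A ∩ B) ≤ F A + F B)
    (h0 : F ∅ = 0) :
    ∃ y, memBaseOn h F y ∧ ∀ k ≤ n, ∑ v ∈ pre e k, y v = F (pre e k ∩ h) := by
  set y : V → ℝ := fun v => F (pre e (e v + 1) ∩ h) - F (pre e (e v) ∩ h) with hy
  have hnot : ∀ k (hk : k < n), e.symm ⟨k, hk⟩ ∉ pre e k := by
    intro k hk; simp [mem_pre]
  have hyk : ∀ k (hk : k < n), y (e.symm ⟨k, hk⟩) = F (pre e (k+1) ∩ h) - F (pre e k ∩ h) := by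
    intro k hk; simp [hy]
  have hpre : ∀ k ≤ n, ∑ v ∈ pre e k, y v = F (pre e k ∩ h) := by
    intro k
    induction k with
    | zero => intro _; simp [pre_zero, h0]
    | succ k ih =>
      intro hk
      have := ih (by omega)
      have h2 := hyk k (by omega)
      have h3 := pre_succ e k (by omega)
      have h4 : ∑ v ∈ pre e (k+1), y v = y (e.symm ⟨k, by omega⟩) + ∑ v ∈ pre e k, y v := by
        rw [h3, Finset.sum_insert (hnot k (by omega))]
      rw [h4, h2, this]; ring
  have hz : ∀ i, i ∉ h → y i = 0 := by
    intro i hi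
    have h3 := pre_succ e (e i) (e i).2
    have h5 : pre e (e i + 1) ∩ h = pre e (e i) ∩ h := by
      rw [h3]; simp [hi]
    simp only [hy]
    rw [h5]; ring
  have hle : ∀ S ⊆ h, ∀ k ≤ n, ∑ v ∈ S ∩ pre e k, y v ≤ F (S ∩ pre e k) := by
    intro S hS k
    induction k with
    | zero => intro _; simp [pre_zero, h0]
    | succ k ih =>
      intro hk
      have ih := ih (by omega)
      have h2 := hyk k (by omega)
      have h3 := pre_succ e k (by omega)
      have h1 := hnot k (by omega)
      set v := e.symm ⟨k, by omega⟩ with hv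
      by_cases hvS : v ∈ S
      · have h4 : S ∩ pre e (k+1) = insert v (S ∩ pre e k) := by
          rw [h3, Finset.inter_insert_of_mem hvS]
        have h5 : ∑ u ∈ S ∩ pre e (k+1), y u = y v + ∑ u ∈ S ∩ pre e k, y u := by
          rw [h4, Finset.sum_insert (by simp [h1])]
        have hs := hsub (S ∩ pre e (k+1)) (pre e k ∩ h)
          (Finset.inter_subset_left.trans hS) Finset.inter_subset_right
        have e1 : (S ∩ pre e (k+1)) ∪ (pre e k ∩ h) = pre e (k+1) ∩ h := by
          rw [h3]; ext u
          have := @hS u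
          have := hS hvS
          simp only [mem_union, mem_inter, mem_insert]
          grind
        have e2 : (S ∩ pre e (k+1)) ∩ (pre e k ∩ h) = S ∩ pre e k := by
          rw [h3]; ext u
          have := @hS u
          simp only [mem_inter, mem_insert]
          grind
        rw [e1, e2] at hs
        rw [h5, h2]; linarith
      · have h4 : S ∩ pre e (k+1) = S ∩ pre e k := by
          rw [h3, Finset.inter_insert_of_notMem hvS]
        rw [h4]; exact ih
  refine ⟨y, ⟨hz, ?_, ?_⟩, hpre⟩
  · have := hpre n le_rfl
    rw [pre_all, Finset.univ_inter] at this
    rw [← this]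
    exact Finset.sum_subset (Finset.subset_univ _) (fun i _ hi => hz i hi)
  · intro S hS
    have := hle S hS n le_rfl
    rwa [pre_all, Finset.inter_univ] at this

lemma lovasz_eq {V : Type*} [Fintype V] [DecidableEq V] {m : ℕ} (e : V ≃ Fin (m+1))
    (h : Finset V) (F : Finset V → ℝ)
    (hsub : ∀ A B : Finset V, A ⊆ h → B ⊆ h → F (A ∪ B) + F (A ∩ B) ≤ F A + F B)
    (h0 : F ∅ = 0) (hh : F h = 0) (a : ℕ → ℝ) (x : V → ℝ) (hx : ∀ v, x v = a (e v))
    (ha : ∀ k < m, a (k+1) ≤ a k) :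
    lovaszOn h F x = ∑ k ∈ range m, (a k - a (k+1)) * F (pre e (k+1) ∩ h) := by
  have htot : ∀ y, memBaseOn h F y → ∑ v, y v = 0 := by
    intro y hy
    rw [← hh, ← hy.2.1]
    exact (Finset.sum_subset (Finset.subset_univ _) (fun i _ hi => hy.1 i hi)).symm
  apply IsGreatest.csSup_eq
  constructor
  · obtain ⟨y, hy, hp⟩ := greedy e h F hsub h0
    refine ⟨y, hy, ?_⟩
    rw [abel e a y x hx, htot y hy, mul_zero, add_zero]
    apply Finset.sum_congr rfl
    intro k hk
    rw [hp _ (by have := Finset.mem_range.1 hk; omega)]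
  · rintro r ⟨y, hy, rfl⟩
    rw [abel e a y x hx, htot y hy, mul_zero, add_zero]
    apply Finset.sum_le_sum
    intro k hk
    apply mul_le_mul_of_nonneg_left _ (by have := ha k (Finset.mem_range.1 hk); linarith)
    have h1 : ∑ v ∈ pre e (k+1), y v = ∑ v ∈ pre e (k+1) ∩ h, y v := by
      symm
      apply Finset.sum_subset Finset.inter_subset_left
      intro i hi hi2
      apply hy.1
      intro h3; exact hi2 (Finset.mem_inter.2 ⟨hi, h3⟩)
    rw [h1]
    exact hy.2.2 _ Finset.inter_subset_right

lemma exists_sort {V : Type*} [Fintype V] [Nonempty V] (x : V → ℝ) :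
    ∃ (m : ℕ) (e : V ≃ Fin (m+1)) (a : ℕ → ℝ), (∀ v, x v = a (e v)) ∧
      (∀ k < m, a (k+1) ≤ a k) := by
  obtain ⟨m, hm⟩ : ∃ m, Fintype.card V = m + 1 :=
    ⟨Fintype.card V - 1, by have := Fintype.card_pos (α := V); omega⟩
  let e0 : V ≃ Fin (m+1) := Fintype.equivFinOfCardEq hm
  let f : Fin (m+1) → ℝ := fun i => - x (e0.symm i)
  let σ := Tuple.sort f
  have hmono : Monotone (f ∘ σ) := Tuple.monotone_sort f
  refine ⟨m, e0.trans σ.symm, fun k => if hk : k < m+1 then - f (σ ⟨k, hk⟩) else 0, ?_, ?_⟩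
  · intro v
    simp [f]
    intro hlt
    have := ((Equiv.symm σ) (e0 v)).2
    omega
  · intro k hk
    simp only [show k < m + 1 by omega, show k + 1 < m + 1 by omega, dif_pos]
    have := @hmono ⟨k, by omega⟩ ⟨k+1, by omega⟩ (by simp [Fin.le_def])
    simp only [Function.comp] at this
    linarith

lemma lovasz_ind {V : Type*} [Fintype V] [DecidableEq V]
    (h : Finset V) (F : Finset V → ℝ)
    (hsub : ∀ A B : Finset V, A ⊆ h → B ⊆ h → F (A ∪ B) + F (A ∩ B) ≤ F A + F B)
    (h0 : F ∅ = 0) (hh : F h = 0) (S : Finset V) (hS : S ≠ ∅) (hS' : S ≠ univ) :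
    lovaszOn h F (fun v => if v ∈ S then 1 else 0) = F (S ∩ h) := by
  obtain ⟨s, hs⟩ := Finset.nonempty_iff_ne_empty.2 hS
  obtain ⟨t, ht⟩ : ∃ t, t ∉ S := by
    by_contra hc
    push Not at hc
    exact hS' (Finset.eq_univ_iff_forall.2 hc)
  have : Nonempty V := ⟨s⟩
  obtain ⟨m, e, a, hx, ha⟩ := exists_sort (fun v => if v ∈ S then (1:ℝ) else 0)
  rw [lovasz_eq e h F hsub h0 hh a _ hx ha]
  have hanti : ∀ i j, i ≤ j → j ≤ m → a j ≤ a i := by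
    intro i j hij
    induction j, hij using Nat.le_induction with
    | base => intro _; exact le_rfl
    | succ j hj ih => intro hm; exact (ha j (by omega)).trans (ih (by omega))
  have h01 : ∀ k ≤ m, a k = 0 ∨ a k = 1 := by
    intro k hk
    have := hx (e.symm ⟨k, by omega⟩)
    simp only [Equiv.apply_symm_apply] at this
    rw [← this]
    split_ifs <;> simp
  have hS1 := hx s
  have hT1 := hx t
  simp only [hs, ht, if_true, if_false] at hS1 hT1
  have b0 : a 0 = 1 := by
    have := hanti 0 (e s) (by omega) (by have := (e s).2; omega)
    rcases h01 0 (by omega) with h | h <;> linarith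
  have bm : a m = 0 := by
    have := hanti (e t) m (by have := (e t).2; omega) le_rfl
    rcases h01 m (by omega) with h | h <;> linarith
  have key : ∀ k ∈ range m, (a k - a (k+1)) * F (pre e (k+1) ∩ h)
      = (a k - a (k+1)) * F (S ∩ h) := by
    intro k hk
    have hk := Finset.mem_range.1 hk
    by_cases hd : a k = a (k+1)
    · simp [hd]
    have hak := ha k hk
    have h1 : a k = 1 ∧ a (k+1) = 0 := by
      rcases h01 k (by omega) with h | h <;> rcases h01 (k+1) (by omega) with h' | h' <;>
        grind
    congr 3
    ext v
    rw [mem_pre]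
    have hv := hx v
    constructor
    · intro hlt
      have := hanti (e v) k (by omega) (by omega)
      by_contra hvS
      rw [if_neg hvS] at hv
      linarith
    · intro hvS
      by_contra hlt
      have := hanti (k+1) (e v) (by omega) (by have := (e v).2; omega)
      rw [if_pos hvS] at hv
      linarith
  rw [Finset.sum_congr rfl key, ← Finset.sum_mul, Finset.sum_range_sub', b0, bm]
  ring

lemma min_submod {V : Type*} [Fintype V] [DecidableEq V] (μ : V → ℝ) (hμ : ∀ i, 0 < μ i)
    (A B : Finset V) :
    min (∑ i ∈ A ∪ B, μ i) (∑ i ∈ (A ∪ B)ᶜ, μ i) + min (∑ i ∈ A ∩ B, μ i) (∑ i ∈ (A ∩ B)ᶜ, μ i)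
    ≤ min (∑ i ∈ A, μ i) (∑ i ∈ Aᶜ, μ i) + min (∑ i ∈ B, μ i) (∑ i ∈ Bᶜ, μ i) := by
  have hc : ∀ S : Finset V, ∑ i ∈ S, μ i + ∑ i ∈ Sᶜ, μ i = ∑ i, μ i :=
    fun S => Finset.sum_add_sum_compl S μ
  have h1 := hc A
  have h2 := hc B
  have h3 := hc (A ∪ B)
  have h4 := hc (A ∩ B)
  have h5 := Finset.sum_union_inter (s₁ := A) (s₂ := B) (f := μ)
  have m1 : ∑ i ∈ A ∩ B, μ i ≤ ∑ i ∈ A, μ i :=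
    Finset.sum_le_sum_of_subset_of_nonneg Finset.inter_subset_left (fun i _ _ => (hμ i).le)
  have m2 : ∑ i ∈ A ∩ B, μ i ≤ ∑ i ∈ B, μ i :=
    Finset.sum_le_sum_of_subset_of_nonneg Finset.inter_subset_right (fun i _ _ => (hμ i).le)
  rcases min_cases (∑ i ∈ A, μ i) (∑ i ∈ Aᶜ, μ i) with ⟨p, _⟩ | ⟨p, _⟩ <;>
  rcases min_cases (∑ i ∈ B, μ i) (∑ i ∈ Bᶜ, μ i) with ⟨q, _⟩ | ⟨q, _⟩ <;>
  rw [p, q] <;>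
  linarith [min_le_left (∑ i ∈ A ∪ B, μ i) (∑ i ∈ (A ∪ B)ᶜ, μ i),
    min_le_right (∑ i ∈ A ∪ B, μ i) (∑ i ∈ (A ∪ B)ᶜ, μ i),
    min_le_left (∑ i ∈ A ∩ B, μ i) (∑ i ∈ (A ∩ B)ᶜ, μ i),
    min_le_right (∑ i ∈ A ∩ B, μ i) (∑ i ∈ (A ∩ B)ᶜ, μ i)]

/-- For a weighted submodular hypergraph with symmetric submodular
cut functions and strictly positive vertex weights, the minimum ratio-cut value
`Ψ_G^* = min_{∅ ≠ S ≠ V} δ_G(S) / min(μ(S), μ(V∖S))` equals the minimum over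
non-constant vectors `x` of the ratio of Lovász extensions `δ̄_G(x) / δ̄_μ(x)`. -/
theorem min_ratio_cut_eq_min_lovasz_ratio
    {V E : Type*} [Fintype V] [DecidableEq V] [Fintype E]
    (hyper : E → Finset V) (w : E → ℝ) (μ : V → ℝ) (δ : E → Finset V → ℝ)
    (hw : ∀ e, 0 < w e) (hμ : ∀ i, 0 < μ i)
    (hsub : ∀ e, ∀ A B : Finset V, A ⊆ hyper e → B ⊆ hyper e →
      δ e (A ∪ B) + δ e (A ∩ B) ≤ δ e A + δ e B)
    (hδ0 : ∀ e, δ e ∅ = 0)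
    (hδh : ∀ e, δ e (hyper e) = 0)
    (hsym : ∀ e, ∀ S ⊆ hyper e, δ e S = δ e (hyper e \ S)) :
    sInf {r | ∃ S : Finset V, S ≠ ∅ ∧ S ≠ Finset.univ ∧
        r = (∑ e, w e * δ e (S ∩ hyper e)) / min (∑ i ∈ S, μ i) (∑ i ∈ Sᶜ, μ i)}
    = sInf {r | ∃ x : V → ℝ, (¬ ∃ c : ℝ, ∀ i, x i = c) ∧
        r = (∑ e, w e * lovaszOn (hyper e) (δ e) x) /
            lovaszOn Finset.univ
              (fun S => min (∑ i ∈ S, μ i) (∑ i ∈ Sᶜ, μ i)) x} := by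
  set g : Finset V → ℝ := fun S => min (∑ i ∈ S, μ i) (∑ i ∈ Sᶜ, μ i) with hg
  set L := {r | ∃ S : Finset V, S ≠ ∅ ∧ S ≠ Finset.univ ∧
        r = (∑ e, w e * δ e (S ∩ hyper e)) / min (∑ i ∈ S, μ i) (∑ i ∈ Sᶜ, μ i)} with hL
  set R := {r | ∃ x : V → ℝ, (¬ ∃ c : ℝ, ∀ i, x i = c) ∧
        r = (∑ e, w e * lovaszOn (hyper e) (δ e) x) / lovaszOn Finset.univ g x} with hR
  have gsub : ∀ A B : Finset V, A ⊆ univ → B ⊆ univ → g (A ∪ B) + g (A ∩ B) ≤ g A + g B :=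
    fun A B _ _ => min_submod μ hμ A B
  have hsum0 : ∀ S : Finset V, 0 ≤ ∑ i ∈ S, μ i :=
    fun S => Finset.sum_nonneg (fun i _ => (hμ i).le)
  have g0 : g ∅ = 0 := by simp only [hg, Finset.sum_empty]; exact min_eq_left (hsum0 _)
  have g1 : g univ = 0 := by
    simp only [hg, Finset.compl_univ, Finset.sum_empty]; exact min_eq_right (hsum0 _)
  have gpos : ∀ S : Finset V, S ≠ ∅ → S ≠ univ → 0 < g S := by
    intro S h1 h2
    refine lt_min (Finset.sum_pos (fun i _ => hμ i) (Finset.nonempty_iff_ne_empty.2 h1))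
      (Finset.sum_pos (fun i _ => hμ i) (Finset.nonempty_iff_ne_empty.2 ?_))
    simpa using h2
  have hLR : L ⊆ R := by
    rintro r ⟨S, h1, h2, rfl⟩
    refine ⟨fun v => if v ∈ S then 1 else 0, ?_, ?_⟩
    · rintro ⟨c, hc⟩
      obtain ⟨s, hs⟩ := Finset.nonempty_iff_ne_empty.2 h1
      apply h2
      rw [Finset.eq_univ_iff_forall]
      intro t
      by_contra ht
      have a1 := hc s
      have a2 := hc t
      simp only [hs, ht, if_true, if_false] at a1 a2
      linarith
    · rw [lovasz_ind univ g gsub g0 g1 S h1 h2, Finset.inter_univ]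
      congr 1
      apply Finset.sum_congr rfl
      intro e _
      rw [lovasz_ind (hyper e) (δ e) (hsub e) (hδ0 e) (hδh e) S h1 h2]
  have hLb : BddBelow L := by
    apply Set.Finite.bddBelow
    apply (Set.finite_range (fun S : Finset V =>
      (∑ e, w e * δ e (S ∩ hyper e)) / min (∑ i ∈ S, μ i) (∑ i ∈ Sᶜ, μ i))).subset
    rintro r ⟨S, _, _, rfl⟩
    exact ⟨S, rfl⟩
  have hcut : ∀ S : Finset V, S ≠ ∅ → S ≠ univ →
      sInf L * g S ≤ ∑ e, w e * δ e (S ∩ hyper e) := by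
    intro S h1 h2
    rw [← le_div_iff₀ (gpos S h1 h2)]
    exact csInf_le hLb ⟨S, h1, h2, rfl⟩
  have hmain : ∀ r ∈ R, L.Nonempty ∧ sInf L ≤ r := by
    rintro r ⟨x, hxc, rfl⟩
    have : Nonempty V := by
      by_contra hV
      rw [not_nonempty_iff] at hV
      exact hxc ⟨0, fun i => hV.elim i⟩
    obtain ⟨m, e, a, hx, ha⟩ := exists_sort x
    have hp1 : ∀ k, pre e (k+1) ≠ ∅ := by
      intro k hk
      have : e.symm 0 ∈ pre e (k+1) := by simp [mem_pre]
      rw [hk] at this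
      simp at this
    have hp2 : ∀ k < m, pre e (k+1) ≠ univ := by
      intro k hk hu
      have : e.symm ⟨m, by omega⟩ ∈ pre e (k+1) := by rw [hu]; simp
      simp [mem_pre] at this
      omega
    obtain ⟨k0, hk0, hlt⟩ : ∃ k < m, a (k+1) < a k := by
      by_contra hc
      push Not at hc
      apply hxc
      refine ⟨a 0, fun v => ?_⟩
      rw [hx]
      have : ∀ j ≤ m, a j = a 0 := by
        intro j
        induction j with
        | zero => intro _; rfl
        | succ j ih =>
          intro hj
          rw [← ih (by omega)]
          exact le_antisymm (ha j (by omega)) (hc j (by omega))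
      exact this _ (by have := (e v).2; omega)
    refine ⟨⟨_, pre e (k0+1), hp1 k0, hp2 k0 hk0, rfl⟩, ?_⟩
    rw [lovasz_eq e univ g gsub g0 g1 a x hx ha]
    simp only [Finset.inter_univ]
    have hden : 0 < ∑ k ∈ range m, (a k - a (k+1)) * g (pre e (k+1)) := by
      apply Finset.sum_pos'
      · intro k hk
        have hk := Finset.mem_range.1 hk
        exact mul_nonneg (by linarith [ha k hk]) (gpos _ (hp1 k) (hp2 k hk)).le
      · exact ⟨k0, Finset.mem_range.2 hk0,
          mul_pos (by linarith) (gpos _ (hp1 k0) (hp2 k0 hk0))⟩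
    rw [le_div_iff₀ hden]
    have hnum : ∑ e', w e' * lovaszOn (hyper e') (δ e') x
        = ∑ k ∈ range m, (a k - a (k+1)) * ∑ e', w e' * δ e' (pre e (k+1) ∩ hyper e') := by
      simp only [Finset.mul_sum]
      rw [Finset.sum_comm]
      apply Finset.sum_congr rfl
      intro e' _
      rw [lovasz_eq e (hyper e') (δ e') (hsub e') (hδ0 e') (hδh e') a x hx ha, Finset.mul_sum]
      apply Finset.sum_congr rfl
      intro k _
      ring
    rw [hnum, Finset.mul_sum]
    apply Finset.sum_le_sum
    intro k hk
    have hk := Finset.mem_range.1 hk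
    have := mul_le_mul_of_nonneg_left (hcut _ (hp1 k) (hp2 k hk))
      (show 0 ≤ a k - a (k+1) by linarith [ha k hk])
    linarith
  by_cases hne : L.Nonempty
  · apply le_antisymm
    · exact le_csInf (hne.mono hLR) (fun r hr => (hmain r hr).2)
    · exact csInf_le_csInf ⟨sInf L, fun r hr => (hmain r hr).2⟩ hne hLR
  · have h1 : L = ∅ := Set.not_nonempty_iff_eq_empty.1 hne
    have h2 : R = ∅ := Set.eq_empty_iff_forall_notMem.2 (fun r hr => hne (hmain r hr).1)
    rw [h1, h2]
end

section
/- Let V be a finite vertex set with positive weights μ, let S ⊆ V with ∅ ≠ S and μ(V \ S) > 0, and let {v_i}_{i∈V} ⊆ ℝ^d be a vector embedding with respect to which S is (σ, 1/3)-robustly separated. Let ε > 0 and let D = (S ∪ (V\S), E_D, w^D) be an ε-approximate matching action with respect to S. Then ∑_{i∈S, j∈V\S} w^D_{ij} · ‖v_i − v_j‖² ≥ σ·(1/3 − 4ε). -/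
open Finset

/-- If `S` is `(σ, 1/3)`-robustly separated with respect to the
embedding `{v_i}` and `D` is an `ε`-approximate matching action with respect to `S`
(encoded by a symmetric non-negative weight function `wD` that is bipartite between `S`
and its complement), then `∑_{i ∈ S, j ∉ S} wD_{ij} ‖v_i − v_j‖² ≥ σ (1/3 − 4ε)`. -/
theorem robustly_separated_matching_action_bound
    {V : Type*} [Fintype V] [DecidableEq V] {d : ℕ}
    (μ : V → ℝ) (hμ : ∀ i, 0 < μ i)
    (S : Finset V) (hS : S.Nonempty) (hSc : 0 < ∑ i ∈ Sᶜ, μ i)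
    (v : V → EuclideanSpace ℝ (Fin d))
    (σ : ℝ) (hσ : 0 < σ)
    -- `S` is `(σ, 1/3)`-robustly separated with respect to `{v_i}`:
    (hrobust : ∃ T : Finset V, T ⊆ Sᶜ ∧
      ((1 : ℝ) / 3) * (∑ i, μ i) ≤ (∑ i ∈ T, μ i) ∧
      ∀ i ∈ S, ∀ j ∈ T, σ / (∑ i ∈ S, μ i) ≤ ‖v i - v j‖ ^ 2)
    (ε : ℝ) (hε : 0 < ε)
    -- `D` is a weighted bipartite graph between `S` and `V ∖ S`:
    (wD : V → V → ℝ)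
    (hsymm : ∀ i j, wD i j = wD j i)
    (hnonneg : ∀ i j, 0 ≤ wD i j)
    (hbip : ∀ i j, wD i j ≠ 0 → (i ∈ S ∧ j ∉ S) ∨ (i ∉ S ∧ j ∈ S))
    -- `D` is an `ε`-approximate matching action w.r.t. `S`, with seed
    -- `s = 1_S − (μ(S)/μ(Sᶜ))·1_{Sᶜ}`:
    (hdeg1 : (∑ i, abs ((∑ j, wD i j) -
        μ i * abs (if i ∈ S then (1 : ℝ) else -((∑ k ∈ S, μ k) / ∑ k ∈ Sᶜ, μ k)))) ≤
      ε * ∑ i, μ i * abs (if i ∈ S then (1 : ℝ) else -((∑ k ∈ S, μ k) / ∑ k ∈ Sᶜ, μ k)))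
    (hdeg2 : ∀ i, (∑ j, wD i j) ≤
      μ i * abs (if i ∈ S then (1 : ℝ) else -((∑ k ∈ S, μ k) / ∑ k ∈ Sᶜ, μ k))) :
    σ * ((1 : ℝ) / 3 - 4 * ε) ≤ ∑ i ∈ S, ∑ j ∈ Sᶜ, wD i j * ‖v i - v j‖ ^ 2 := by
  obtain ⟨T, hTS, hTμ, hT⟩ := hrobust
  set m := ∑ i ∈ S, μ i with hm
  set M := ∑ i ∈ Sᶜ, μ i with hM
  have hm0 : 0 < m := Finset.sum_pos (fun i _ => hμ i) hS
  have htot : ∑ i, μ i = m + M := (Finset.sum_add_sum_compl S μ).symm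
  have hr0 : 0 < m / M := div_pos hm0 hSc
  have habs : ∀ i, abs (if i ∈ S then (1 : ℝ) else -(m / M)) = if i ∈ S then 1 else m / M := by
    intro i
    split_ifs
    · simp
    · rw [abs_neg, abs_of_pos hr0]
  simp only [habs] at hdeg1 hdeg2
  have hnorm : ∑ i, μ i * (if i ∈ S then 1 else m / M) = 2 * m := by
    rw [← Finset.sum_add_sum_compl S]
    have h1 : ∑ i ∈ S, μ i * (if i ∈ S then 1 else m / M) = m := by
      rw [hm]
      exact Finset.sum_congr rfl (fun i hi => by simp [hi])
    have h2 : ∑ i ∈ Sᶜ, μ i * (if i ∈ S then 1 else m / M) = M * (m / M) := by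
      rw [hM, Finset.sum_mul]
      refine Finset.sum_congr rfl (fun i hi => ?_)
      rw [if_neg (Finset.mem_compl.mp hi)]
    rw [h1, h2, mul_div_cancel₀ _ hSc.ne']
    ring
  rw [hnorm] at hdeg1
  -- lower bound on the degree mass of `T`
  have hdegT : m / M * ∑ j ∈ T, μ j - ε * (2 * m) ≤ ∑ j ∈ T, ∑ i, wD j i := by
    have h1 : ∑ j ∈ T, (μ j * (m / M) - ∑ i, wD j i) ≤ ε * (2 * m) := by
      refine le_trans ?_ hdeg1
      refine le_trans ?_ (Finset.sum_le_sum_of_subset_of_nonneg (Finset.subset_univ T)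
        (fun i _ _ => abs_nonneg _))
      refine Finset.sum_le_sum (fun j hj => ?_)
      rw [if_neg (Finset.mem_compl.mp (hTS hj)), abs_sub_comm]
      exact le_abs_self _
    rw [Finset.sum_sub_distrib, ← Finset.sum_mul] at h1
    linarith
  have hrT : m / 3 ≤ m / M * ∑ j ∈ T, μ j := by
    have h1 : M / 3 ≤ ∑ j ∈ T, μ j := by rw [htot] at hTμ; linarith
    calc m / 3 = m / M * (M / 3) := by field_simp
      _ ≤ _ := mul_le_mul_of_nonneg_left h1 hr0.le
  have hdS : ∀ j ∈ T, ∑ i, wD j i = ∑ i ∈ S, wD i j := by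
    intro j hj
    have hjS := Finset.mem_compl.mp (hTS hj)
    rw [← Finset.sum_subset (Finset.subset_univ S)]
    · exact Finset.sum_congr rfl (fun i _ => hsymm j i)
    · intro i _ hi
      by_contra h
      rcases hbip j i h with h | h
      · exact hjS h.1
      · exact hi h.2
  rw [Finset.sum_congr rfl hdS, Finset.sum_comm] at hdegT
  have hfin : σ / m * ∑ i ∈ S, ∑ j ∈ T, wD i j ≤
      ∑ i ∈ S, ∑ j ∈ Sᶜ, wD i j * ‖v i - v j‖ ^ 2 := by
    rw [Finset.mul_sum]
    refine Finset.sum_le_sum (fun i hi => ?_)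
    refine le_trans ?_ (Finset.sum_le_sum_of_subset_of_nonneg hTS
      (fun j _ _ => mul_nonneg (hnonneg i j) (sq_nonneg _)))
    rw [Finset.mul_sum]
    refine Finset.sum_le_sum (fun j hj => ?_)
    rw [mul_comm]
    exact mul_le_mul_of_nonneg_left (hT i hi j hj) (hnonneg i j)
  refine le_trans ?_ hfin
  calc σ * ((1 : ℝ) / 3 - 4 * ε) ≤ σ * (1 / 3 - 2 * ε) :=
        mul_le_mul_of_nonneg_left (by linarith) hσ.le
    _ = σ / m * (m / 3 - ε * (2 * m)) := by field_simp
    _ ≤ _ := mul_le_mul_of_nonneg_left (by linarith) (div_pos hσ hm0).le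
end

section
/- Let G = (V, E, w, μ) be a weighted submodular hypergraph with monotone submodular cut functions δ_h(S) = min{F_h(S), F_h(h\S)}. For every cut S ⊆ V with 0 < μ(S) ≤ μ(V\S), there exists a feasible solution ({v_i}_{i∈V}, {ℓ^h}_{h∈E}) to the RC-Metric program whose objective value satisfies ∑_{h∈E} w_h·‖ℓ^h‖_{F_h} ≤ 2·Ψ_G(S). In particular, the optimal value of RC-Metric is at most 2·Ψ_G^*. -/
open Finset

/-- The norm `‖x‖_{F_h} = max_{y ∈ P_sym(F_h)} ⟨y, x⟩` on `ℝ^h`. -/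
noncomputable def normFOn {V : Type*} [Fintype V] [DecidableEq V]
    (h : Finset V) (F : Finset V → ℝ) (x : V → ℝ) : ℝ :=
  sSup {r | ∃ y : V → ℝ, memSymPolyOn h F y ∧ r = ∑ i, y i * x i}

/-- For a weighted submodular hypergraph with monotone submodular
cut functions `δ_h(S) = min (F_h S) (F_h (h∖S))` and any cut `S` with
`0 < μ(S) ≤ μ(V∖S)`, the RC-Metric program has a feasible solution
(`v : V → ℝ^n`, lengths `ℓ^h ∈ ℝ^h`) with objective value
`∑_h w_h ‖ℓ^h‖_{F_h} ≤ 2·Ψ_G(S)`. -/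
theorem rc_metric_is_relaxation
    {V E : Type*} [Fintype V] [DecidableEq V] [Fintype E]
    (hyper : E → Finset V) (w : E → ℝ) (μ : V → ℝ)
    (F : E → Finset V → ℝ)
    (hw : ∀ e, 0 < w e) (hμ : ∀ i, 0 ≤ μ i)
    (hsub : ∀ e, ∀ A B : Finset V, A ⊆ hyper e → B ⊆ hyper e →
      F e (A ∪ B) + F e (A ∩ B) ≤ F e A + F e B)
    (hmono : ∀ e, ∀ A B : Finset V, A ⊆ B → B ⊆ hyper e → F e A ≤ F e B)
    (hF0 : ∀ e, F e ∅ = 0)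
    (hFi : ∀ e, ∀ i ∈ hyper e, 0 < F e {i})
    (S : Finset V)
    (hS0 : 0 < ∑ i ∈ S, μ i)
    (hSbal : (∑ i ∈ S, μ i) ≤ ∑ i ∈ Sᶜ, μ i) :
    ∃ (v : V → EuclideanSpace ℝ V) (ℓ : E → V → ℝ),
      -- `ℓ^h ∈ ℝ^h`:
      (∀ e, ∀ i, i ∉ hyper e → ℓ e i = 0) ∧
      -- constraint (i): spreading
      1 ≤ (1 : ℝ) / 2 * ∑ i, ∑ j, (μ i * μ j / ∑ k, μ k) * ‖v i - v j‖ ^ 2 ∧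
      -- constraint (ii): lengths dominate squared distances within hyperedges
      (∀ e, ∀ i ∈ hyper e, ∀ j ∈ hyper e, i ≠ j →
        ‖v i - v j‖ ^ 2 ≤ ℓ e i + ℓ e j) ∧
      -- constraint (iii): ℓ₂² triangle inequalities
      (∀ i j k : V, ‖v i - v j‖ ^ 2 ≤ ‖v i - v k‖ ^ 2 + ‖v k - v j‖ ^ 2) ∧
      -- the objective value is at most `2·Ψ_G(S)`:
      (∑ e, w e * normFOn (hyper e) (F e) (ℓ e)) ≤
        2 * ((∑ e, w e * min (F e (S ∩ hyper e)) (F e (hyper e \ S))) /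
          min (∑ i ∈ S, μ i) (∑ i ∈ Sᶜ, μ i)) := by
  classical
  obtain ⟨i0, -, -⟩ : ∃ i ∈ S, μ i ≠ 0 := Finset.exists_ne_zero_of_sum_ne_zero hS0.ne'
  have hT0 : 0 < ∑ i ∈ Sᶜ, μ i := lt_of_lt_of_le hS0 hSbal
  have htot : ∑ k, μ k = ∑ i ∈ S, μ i + ∑ i ∈ Sᶜ, μ i :=
    (Finset.sum_add_sum_compl S μ).symm
  rw [min_eq_left hSbal]
  set a := ∑ i ∈ S, μ i with ha
  set b := ∑ i ∈ Sᶜ, μ i with hb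
  set C : ℝ := (a + b) / (a * b) with hC
  have hC0 : 0 < C := by positivity
  have hC2 : C ≤ 2 / a := by
    rw [hC, div_le_div_iff₀ (by positivity) hS0]
    nlinarith
  let v : V → EuclideanSpace ℝ V := fun i =>
    if i ∈ S then EuclideanSpace.single i0 (Real.sqrt C) else 0
  have hd : ∀ i j, ‖v i - v j‖ ^ 2 = if (i ∈ S ↔ j ∈ S) then 0 else C := by
    intro i j
    by_cases hi : i ∈ S <;> by_cases hj : j ∈ S <;>
      simp [v, hi, hj, Real.sq_sqrt hC0.le]
  let T : E → Finset V := fun e =>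
    if F e (S ∩ hyper e) ≤ F e (hyper e \ S) then S ∩ hyper e else hyper e \ S
  have hTsub : ∀ e, T e ⊆ hyper e := by
    intro e
    by_cases h : F e (S ∩ hyper e) ≤ F e (hyper e \ S)
    · simp only [T, h, if_true]; exact Finset.inter_subset_right
    · simp only [T, h, if_false]; exact Finset.sdiff_subset
  have hTF : ∀ e, F e (T e) = min (F e (S ∩ hyper e)) (F e (hyper e \ S)) := by
    intro e
    by_cases h : F e (S ∩ hyper e) ≤ F e (hyper e \ S)
    · simp only [T, h, if_true, min_eq_left]
    · simp only [T, h, if_false]; rw [min_eq_right (le_of_not_ge h)]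
  have hTmem : ∀ e, ∀ i ∈ hyper e, ∀ j ∈ hyper e, ¬ (i ∈ S ↔ j ∈ S) → i ∈ T e ∨ j ∈ T e := by
    intro e i hi j hj hij
    by_cases h : F e (S ∩ hyper e) ≤ F e (hyper e \ S)
    · simp only [T, h, if_true, Finset.mem_inter]; tauto
    · simp only [T, h, if_false, Finset.mem_sdiff]; tauto
  refine ⟨v, fun e i => if i ∈ T e then C else 0, ?_, ?_, ?_, ?_, ?_⟩
  · intro e i hi
    exact if_neg (fun h => hi (hTsub e h))
  · have key : ∑ i, ∑ j, (μ i * μ j / ∑ k, μ k) * ‖v i - v j‖ ^ 2 = 2 * (a * b / (a + b) * C) := by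
      rw [htot]
      have h1 : ∀ i ∈ S, ∑ j, (μ i * μ j / (a + b)) * ‖v i - v j‖ ^ 2
          = μ i * (b / (a + b) * C) := by
        intro i hi
        rw [← Finset.sum_add_sum_compl S, Finset.sum_eq_zero, zero_add, hb,
          Finset.sum_div, Finset.sum_mul, Finset.mul_sum]
        · refine Finset.sum_congr rfl fun j hj => ?_
          rw [hd, if_neg (by simp at hj; tauto)]; ring
        · intro j hj
          rw [hd, if_pos (by tauto), mul_zero]
      have h2 : ∀ i ∈ Sᶜ, ∑ j, (μ i * μ j / (a + b)) * ‖v i - v j‖ ^ 2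
          = μ i * (a / (a + b) * C) := by
        intro i hi
        rw [Finset.mem_compl] at hi
        rw [← Finset.sum_add_sum_compl S, add_comm, Finset.sum_eq_zero, zero_add]
        · rw [show a / (a + b) * C = ∑ j ∈ S, μ j / (a + b) * C by
            rw [ha, Finset.sum_div, Finset.sum_mul], Finset.mul_sum]
          refine Finset.sum_congr rfl fun j hj => ?_
          rw [hd, if_neg (by tauto)]; ring
        · intro j hj
          rw [Finset.mem_compl] at hj
          rw [hd, if_pos (by tauto), mul_zero]
      rw [← Finset.sum_add_sum_compl S, Finset.sum_congr rfl h1, Finset.sum_congr rfl h2,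
        ← Finset.sum_mul, ← Finset.sum_mul, ← ha, ← hb]
      ring
    rw [key, hC]
    apply le_of_eq
    field_simp
  · intro e i hi j hj _
    rw [hd]
    have hn : ∀ k, (0 : ℝ) ≤ if k ∈ T e then C else 0 := fun k => by split_ifs <;> linarith
    by_cases hij : i ∈ S ↔ j ∈ S
    · rw [if_pos hij]; exact add_nonneg (hn i) (hn j)
    · rw [if_neg hij]
      rcases hTmem e i hi j hj hij with h | h
      · have := hn j
        simp only [if_pos h]; linarith
      · have := hn i
        simp only [if_pos h]; linarith
  · intro i j k
    rw [hd, hd, hd]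
    by_cases hi : i ∈ S <;> by_cases hj : j ∈ S <;> by_cases hk : k ∈ S <;>
      simp [hi, hj, hk, hC0.le]
  · rw [← mul_div_assoc, Finset.mul_sum, Finset.sum_div]
    refine Finset.sum_le_sum fun e _ => ?_
    rw [← hTF]
    have hF : 0 ≤ F e (T e) := by
      rw [← hF0 e]; exact hmono e _ _ (Finset.empty_subset _) (hTsub e)
    have hnorm : normFOn (hyper e) (F e) (fun i => if i ∈ T e then C else 0) ≤ C * F e (T e) := by
      refine Real.sSup_le ?_ (by positivity)
      rintro r ⟨y, ⟨-, hy⟩, rfl⟩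
      have : ∑ i, y i * (if i ∈ T e then C else 0) = C * ∑ i ∈ T e, y i := by
        simp [Finset.mul_sum, mul_comm]
      rw [this]
      exact mul_le_mul_of_nonneg_left
        ((Finset.sum_le_sum fun i _ => le_abs_self (y i)).trans (hy _ (hTsub e))) hC0.le
    calc w e * normFOn (hyper e) (F e) (fun i => if i ∈ T e then C else 0)
        ≤ w e * (2 / a * F e (T e)) :=
          mul_le_mul_of_nonneg_left
            (hnorm.trans (mul_le_mul_of_nonneg_right hC2 hF)) (hw e).le
      _ = 2 * (w e * F e (T e)) / a := by ring
end

section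
/- Let G = (V, E, w, μ) be a weighted submodular hypergraph with monotone submodular cut functions δ_h induced by F_h, and let ({v_i}_{i∈V}, {ℓ^h}_{h∈E}) be a feasible solution to the RC-Metric program with ℓ^h ≥ 0 coordinatewise and objective value opt = ∑_{h∈E} w_h·‖ℓ^h‖_{F_h}. Suppose φ : {v_i} → ℝ is 1-Lipschitz with respect to the squared Euclidean distance (|φ(v_i) − φ(v_j)| ≤ ‖v_i − v_j‖² for all i, j), and suppose for some K > 0 that ∑_{i,j∈V} (μ_i μ_j/μ(V))·‖v_i − v_j‖² ≤ K·∑_{i,j∈V} (μ_i μ_j/μ(V))·|φ(v_i) − φ(v_j)|. Then the vector x ∈ ℝ^V with x_i = φ(v_i) satisfies ∑_{h∈E} w_h·δ̄_h(x) ≤ 4K·opt·min_{γ∈ℝ} ‖x − γ·1‖_{1,μ}, where δ̄_h is the Lovász extension of δ_h and ‖z‖_{1,μ} = ∑_i μ_i|z_i|. -/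
open Finset

lemma rcaux_point {V : Type*} [DecidableEq V] (h : Finset V) (x l : V → ℝ)
    (hl : ∀ i, 0 ≤ l i)
    (hd : ∀ i ∈ h, ∀ j ∈ h, i ≠ j → |x i - x j| ≤ l i + l j) :
    ∃ γ : ℝ, ∀ i ∈ h, |x i - γ| ≤ l i := by
  rcases h.eq_empty_or_nonempty with rfl | hne
  · exact ⟨0, by simp⟩
  · obtain ⟨k, hk, hmax⟩ := h.exists_max_image (fun i => x i - l i) hne
    refine ⟨x k - l k, fun i hi => ?_⟩
    have h1 := hmax i hi
    have h3 := hl i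
    rw [abs_le]
    refine ⟨?_, by linarith⟩
    by_cases hik : i = k
    · subst hik; linarith
    · have := (abs_le.1 (hd i hi k hk hik)).1
      linarith

lemma rcaux_bdd {V : Type*} [Fintype V] [DecidableEq V] (h : Finset V) (F : Finset V → ℝ)
    (l : V → ℝ) (hl : ∀ i, 0 ≤ l i) :
    BddAbove {r | ∃ y : V → ℝ, memSymPolyOn h F y ∧ r = ∑ i, y i * l i} := by
  refine ⟨∑ i, |F {i}| * l i, ?_⟩
  rintro r ⟨y, ⟨hy0, hy⟩, rfl⟩
  refine Finset.sum_le_sum fun i _ => mul_le_mul_of_nonneg_right ?_ (hl i)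
  by_cases hi : i ∈ h
  · have := hy {i} (by simpa using hi)
    simp only [Finset.sum_singleton] at this
    exact (le_abs_self _).trans (this.trans (le_abs_self _))
  · rw [hy0 i hi]; positivity

lemma rcaux_norm_nonneg {V : Type*} [Fintype V] [DecidableEq V] (h : Finset V)
    (F : Finset V → ℝ) (l : V → ℝ) (hl : ∀ i, 0 ≤ l i)
    (hF : ∀ S ⊆ h, 0 ≤ F S) : 0 ≤ normFOn h F l := by
  refine le_csSup (rcaux_bdd h F l hl) ⟨fun _ => 0, ⟨fun _ _ => rfl, fun S hS => ?_⟩, by simp⟩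
  simpa using hF S hS

lemma rcaux_edge {V : Type*} [Fintype V] [DecidableEq V] (h : Finset V)
    (F : Finset V → ℝ)
    (hmono : ∀ A B : Finset V, A ⊆ B → B ⊆ h → F A ≤ F B) (hF0 : F ∅ = 0)
    (x l : V → ℝ) (hl : ∀ i, 0 ≤ l i)
    (hd : ∀ i ∈ h, ∀ j ∈ h, i ≠ j → |x i - x j| ≤ l i + l j) :
    lovaszOn h (fun S => min (F S) (F (h \ S))) x ≤ 2 * normFOn h F l := by
  have hFn : ∀ S ⊆ h, 0 ≤ F S := fun S hS => hF0 ▸ hmono ∅ S (by simp) hS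
  have hn := rcaux_norm_nonneg h F l hl hFn
  refine Real.sSup_le ?_ (by positivity)
  rintro r ⟨y, ⟨hy0, hyh, hy⟩, rfl⟩
  obtain ⟨γ, hγ⟩ := rcaux_point h x l hl hd
  have hyh0 : ∑ i ∈ h, y i = 0 := by
    rw [hyh]; simp [hF0, hFn h subset_rfl]
  have hup : ∀ S ⊆ h, ∑ i ∈ S, y i ≤ F S := fun S hS => (hy S hS).trans (min_le_left _ _)
  have hlo : ∀ S ⊆ h, -F S ≤ ∑ i ∈ S, y i := by
    intro S hS
    have h1 := hy (h \ S) Finset.sdiff_subset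
    have h2 := Finset.sum_sdiff (f := y) hS
    have h3 := h1.trans (min_le_right _ _)
    rw [Finset.sdiff_sdiff_eq_self hS] at h3
    linarith
  have hmem : memSymPolyOn h F (fun i => |y i| / 2) := by
    refine ⟨fun i hi => by simp [hy0 i hi], fun S hS => ?_⟩
    have e1 : ∑ i ∈ S, |(|y i| / 2)| = (∑ i ∈ S, |y i|) / 2 := by
      rw [Finset.sum_div]
      refine Finset.sum_congr rfl fun i _ => abs_of_nonneg (by positivity)
    have e2 := Finset.sum_filter_add_sum_filter_not S (fun i => 0 ≤ y i) (fun i => |y i|)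
    have e3 : ∑ i ∈ S with 0 ≤ y i, |y i| = ∑ i ∈ S with 0 ≤ y i, y i :=
      Finset.sum_congr rfl fun i hi => abs_of_nonneg (Finset.mem_filter.1 hi).2
    have e4 : ∑ i ∈ S with ¬ 0 ≤ y i, |y i| = -∑ i ∈ S with ¬ 0 ≤ y i, y i := by
      rw [← Finset.sum_neg_distrib]
      exact Finset.sum_congr rfl fun i hi =>
        abs_of_neg (not_le.1 (Finset.mem_filter.1 hi).2)
    have s1 : (S.filter fun i => 0 ≤ y i) ⊆ S := Finset.filter_subset _ _
    have s2 : (S.filter fun i => ¬ 0 ≤ y i) ⊆ S := Finset.filter_subset _ _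
    have a1 := hup _ (s1.trans hS)
    have a2 := hlo _ (s2.trans hS)
    have b1 := hmono _ _ s1 hS
    have b2 := hmono _ _ s2 hS
    rw [e1]
    linarith
  have hle : ∑ i, |y i| / 2 * l i ≤ normFOn h F l :=
    le_csSup (rcaux_bdd h F l hl) ⟨_, hmem, rfl⟩
  have hsum0 : ∑ i, y i = 0 := by
    rw [← hyh0]
    exact (Finset.sum_subset (Finset.subset_univ h) fun i _ hi => hy0 i hi).symm
  have hshift : ∑ i, y i * x i = ∑ i, y i * (x i - γ) := by
    simp only [mul_sub, Finset.sum_sub_distrib, ← Finset.sum_mul, hsum0]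
    ring
  have hfin : ∑ i, y i * (x i - γ) ≤ 2 * ∑ i, |y i| / 2 * l i := by
    rw [Finset.mul_sum]
    refine Finset.sum_le_sum fun i _ => ?_
    by_cases hi : i ∈ h
    · calc y i * (x i - γ) ≤ |y i| * |x i - γ| := by
            rw [← abs_mul]; exact le_abs_self _
        _ ≤ |y i| * l i := mul_le_mul_of_nonneg_left (hγ i hi) (abs_nonneg _)
        _ = 2 * (|y i| / 2 * l i) := by ring
    · simp [hy0 i hi]
  linarith

lemma rcaux_spread {V : Type*} [Fintype V] (μ : V → ℝ) (hμ : ∀ i, 0 ≤ μ i)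
    (hμtot : 0 < ∑ i, μ i) (x : V → ℝ) (γ : ℝ) :
    ∑ i, ∑ j, (μ i * μ j / ∑ k, μ k) * |x i - x j| ≤ 2 * ∑ i, μ i * |x i - γ| := by
  set M := ∑ k, μ k with hM
  have h1 : ∑ i, ∑ j, (μ i * μ j / M) * |x i - x j| ≤
      ∑ i, ∑ j, ((μ i * |x i - γ|) * μ j / M + μ i * (μ j * |x j - γ|) / M) := by
    refine Finset.sum_le_sum fun i _ => Finset.sum_le_sum fun j _ => ?_
    have h2 : |x i - x j| ≤ |x i - γ| + |x j - γ| := by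
      have := abs_sub_le (x i) γ (x j)
      rwa [abs_sub_comm γ] at this
    have h3 : 0 ≤ μ i * μ j / M := div_nonneg (mul_nonneg (hμ i) (hμ j)) hμtot.le
    calc _ ≤ (μ i * μ j / M) * (|x i - γ| + |x j - γ|) := mul_le_mul_of_nonneg_left h2 h3
      _ = _ := by ring
  refine h1.trans (le_of_eq ?_)
  simp only [Finset.sum_add_distrib, ← Finset.sum_div, ← Finset.mul_sum, ← Finset.sum_mul]
  rw [← hM]
  field_simp
  ring

/-- rounding the metric relaxation. Given a feasible solution
`({v_i}, {ℓ^h})` of the RC-Metric program with `ℓ^h ≥ 0` and objective value `opt`,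
and a `1`-Lipschitz (w.r.t. squared Euclidean distance) map `φ` realized by
`x i = φ(v i)` whose average distortion is at most `K`, the vector `x` satisfies
`∑_h w_h δ̄_h(x) ≤ 4K · opt · min_γ ‖x − γ·1‖_{1,μ}`. -/
theorem rc_metric_rounding
    {V E : Type*} [Fintype V] [DecidableEq V] [Fintype E]
    (hyper : E → Finset V) (w : E → ℝ) (μ : V → ℝ)
    (F : E → Finset V → ℝ)
    (hw : ∀ e, 0 < w e) (hμ : ∀ i, 0 ≤ μ i) (hμtot : 0 < ∑ i, μ i)
    (hsub : ∀ e, ∀ A B : Finset V, A ⊆ hyper e → B ⊆ hyper e →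
      F e (A ∪ B) + F e (A ∩ B) ≤ F e A + F e B)
    (hmono : ∀ e, ∀ A B : Finset V, A ⊆ B → B ⊆ hyper e → F e A ≤ F e B)
    (hF0 : ∀ e, F e ∅ = 0)
    (hFi : ∀ e, ∀ i ∈ hyper e, 0 < F e {i})
    -- a feasible solution of RC-Metric with non-negative lengths:
    (v : V → EuclideanSpace ℝ V) (ℓ : E → V → ℝ)
    (hℓsupp : ∀ e, ∀ i, i ∉ hyper e → ℓ e i = 0)
    (hℓnonneg : ∀ e i, 0 ≤ ℓ e i)
    (hspread : 1 ≤ (1 : ℝ) / 2 * ∑ i, ∑ j, (μ i * μ j / ∑ k, μ k) * ‖v i - v j‖ ^ 2)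
    (hlen : ∀ e, ∀ i ∈ hyper e, ∀ j ∈ hyper e, i ≠ j →
      ‖v i - v j‖ ^ 2 ≤ ℓ e i + ℓ e j)
    (htri : ∀ i j k : V, ‖v i - v j‖ ^ 2 ≤ ‖v i - v k‖ ^ 2 + ‖v k - v j‖ ^ 2)
    -- `x i = φ(v i)` for a `1`-Lipschitz (w.r.t. `‖·‖²`) map `φ`:
    (x : V → ℝ)
    (hlip : ∀ i j, |x i - x j| ≤ ‖v i - v j‖ ^ 2)
    -- `φ` has average distortion at most `K`:
    (K : ℝ) (hK : 0 < K)
    (hdist : (∑ i, ∑ j, (μ i * μ j / ∑ k, μ k) * ‖v i - v j‖ ^ 2) ≤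
      K * ∑ i, ∑ j, (μ i * μ j / ∑ k, μ k) * |x i - x j|) :
    (∑ e, w e * lovaszOn (hyper e)
        (fun S => min (F e S) (F e (hyper e \ S))) x) ≤
      4 * K * (∑ e, w e * normFOn (hyper e) (F e) (ℓ e)) *
        sInf {r | ∃ γ : ℝ, r = ∑ i, μ i * |x i - γ|} := by
  have hnn : ∀ e, 0 ≤ normFOn (hyper e) (F e) (ℓ e) := fun e =>
    rcaux_norm_nonneg _ _ _ (hℓnonneg e) fun S hS => hF0 e ▸ hmono e ∅ S (by simp) hS
  have hopt : 0 ≤ ∑ e, w e * normFOn (hyper e) (F e) (ℓ e) :=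
    Finset.sum_nonneg fun e _ => mul_nonneg (hw e).le (hnn e)
  have hleft : (∑ e, w e * lovaszOn (hyper e)
        (fun S => min (F e S) (F e (hyper e \ S))) x) ≤
      2 * ∑ e, w e * normFOn (hyper e) (F e) (ℓ e) := by
    rw [Finset.mul_sum]
    refine Finset.sum_le_sum fun e _ => ?_
    have := rcaux_edge (hyper e) (F e) (hmono e) (hF0 e) x (ℓ e) (hℓnonneg e)
      (fun i hi j hj hij => (hlip i j).trans (hlen e i hi j hj hij))
    have := mul_le_mul_of_nonneg_left this (hw e).le
    linarith
  have hinf : 1 / K ≤ sInf {r | ∃ γ : ℝ, r = ∑ i, μ i * |x i - γ|} := by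
    refine le_csInf ⟨_, 0, rfl⟩ ?_
    rintro r ⟨γ, rfl⟩
    have h1 := mul_le_mul_of_nonneg_left (rcaux_spread μ hμ hμtot x γ) hK.le
    rw [div_le_iff₀ hK]
    linarith
  have h4 : 1 ≤ K * sInf {r | ∃ γ : ℝ, r = ∑ i, μ i * |x i - γ|} := by
    rw [div_le_iff₀ hK] at hinf
    linarith
  have h5 := mul_le_mul_of_nonneg_left h4 hopt
  linarith
end
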